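/- arXiv:math/9802027 — 2 statements merged into one kernel-verified Lean document; each statement's English description precedes it below -/
import Mathlib

section
/- If the coefficient systems (P,Q,R,S) on U and (P̃,Q̃,R̃,S̃) on Ũ are related by the point-transformation rule via φ, then the pair α = (B, −A) is pseudovectorial of weight 2: at every point of U, B = (det T)²·(S¹₁·(B̃∘φ) − S¹₂·(Ã∘φ)) and −A = (det T)²·(S²₁·(B̃∘φ) − S²₂·(Ã∘φ)). -/
noncomputable section

open Real

/-- Partial derivative in the first argument (`f_{1.0}`). -/
def pdx (f : ℝ → ℝ → ℝ) : ℝ → ℝ → ℝ := fun x y => deriv (fun t => f t y) x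

/-- Partial derivative in the second argument (`f_{0.1}`). -/
def pdy (f : ℝ → ℝ → ℝ) : ℝ → ℝ → ℝ := fun x y => deriv (fun t => f x t) y

/-- Indexed partial derivative: `0 ↦ ∂/∂x`, `1 ↦ ∂/∂y`. -/
def pd (i : Fin 2) (f : ℝ → ℝ → ℝ) : ℝ → ℝ → ℝ := if i = 0 then pdx f else pdy f

/-- Smoothness of a two-variable real function on a set `U ⊆ ℝ²`. -/
def Smooth2 (U : Set (ℝ × ℝ)) (f : ℝ → ℝ → ℝ) : Prop :=
  ContDiffOn ℝ (⊤ : ℕ∞) (Function.uncurry f) U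

/-- The quantity `A` of formula (1.6). -/
def coefA (P Q R S : ℝ → ℝ → ℝ) : ℝ → ℝ → ℝ := fun x y =>
  pdy (pdy P) x y - 2 * pdx (pdy Q) x y + pdx (pdx R) x y
    + 2 * P x y * pdx S x y + S x y * pdx P x y
    - 3 * P x y * pdy R x y - 3 * R x y * pdy P x y
    - 3 * Q x y * pdx R x y + 6 * Q x y * pdy Q x y

/-- The quantity `B` of formula (1.6). -/
def coefB (P Q R S : ℝ → ℝ → ℝ) : ℝ → ℝ → ℝ := fun x y =>
  pdx (pdx S) x y - 2 * pdx (pdy R) x y + pdy (pdy Q) x y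
    - 2 * S x y * pdy P x y - P x y * pdy S x y
    + 3 * S x y * pdx Q x y + 3 * Q x y * pdx S x y
    + 3 * R x y * pdy Q x y - 6 * R x y * pdx R x y

/-- The fully covariant symbol `θ_{ijk}` of (2.7) built from the ODE coefficients. -/
def thetaLow (P Q R S : ℝ → ℝ → ℝ) (i j k : Fin 2) : ℝ → ℝ → ℝ :=
  match i.1 + j.1 + k.1 with
  | 0 => P
  | 1 => Q
  | 2 => R
  | _ => S

/-- The symbol `θ^k_{ij}` of (2.8), obtained by raising the first index with `d^{kr}`. -/
def thetaUp (P Q R S : ℝ → ℝ → ℝ) (k i j : Fin 2) : ℝ → ℝ → ℝ :=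
  if k = 0 then thetaLow P Q R S 1 i j
  else fun x y => -(thetaLow P Q R S 0 i j x y)

/-- Jacobian matrix entry `T^p_i = ∂x̃^p/∂x^i` of the point transformation `φ = (xt, yt)`. -/
def Jmat (xt yt : ℝ → ℝ → ℝ) (p i : Fin 2) : ℝ → ℝ → ℝ :=
  pd i (if p = 0 then xt else yt)

/-- The Jacobian determinant `det T`. -/
def Jdet (xt yt : ℝ → ℝ → ℝ) : ℝ → ℝ → ℝ := fun x y =>
  Jmat xt yt 0 0 x y * Jmat xt yt 1 1 x y - Jmat xt yt 0 1 x y * Jmat xt yt 1 0 x y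

/-- The pointwise inverse Jacobian matrix `S = T⁻¹`. -/
def Jinv (xt yt : ℝ → ℝ → ℝ) (k m : Fin 2) : ℝ → ℝ → ℝ := fun x y =>
  (if k = 0 then (if m = 0 then Jmat xt yt 1 1 x y else -(Jmat xt yt 0 1 x y))
   else (if m = 0 then -(Jmat xt yt 1 0 x y) else Jmat xt yt 0 0 x y)) / Jdet xt yt x y

/-- `σ̃_i = ∂_i (det T) / det T`. -/
def sigmaT (xt yt : ℝ → ℝ → ℝ) (i : Fin 2) : ℝ → ℝ → ℝ := fun x y =>
  pd i (Jdet xt yt) x y / Jdet xt yt x y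

/-- The two coefficient systems are related by the point-transformation rule (2.9). -/
def PointRelated (U : Set (ℝ × ℝ)) (xt yt P Q R S Pt Qt Rt St : ℝ → ℝ → ℝ) : Prop :=
  ∀ i j k : Fin 2, ∀ x y : ℝ, (x, y) ∈ U →
    thetaUp P Q R S k i j x y =
      (∑ m : Fin 2, ∑ p : Fin 2, ∑ q : Fin 2,
        Jinv xt yt k m x y * Jmat xt yt p i x y * Jmat xt yt q j x y *
          thetaUp Pt Qt Rt St m p q (xt x y) (yt x y))
      + (∑ m : Fin 2, Jinv xt yt k m x y * pd j (Jmat xt yt m i) x y)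
      - (sigmaT xt yt i x y * (if k = j then (1:ℝ) else 0)
          + sigmaT xt yt j x y * (if k = i then (1:ℝ) else 0)) / 3

theorem sm_has {U : Set (ℝ × ℝ)} (hU : IsOpen U) {f : ℝ → ℝ → ℝ} (hf : Smooth2 U f) {x y : ℝ}
    (hp : (x, y) ∈ U) : HasFDerivAt (Function.uncurry f) (fderiv ℝ (Function.uncurry f) (x, y)) (x, y) :=
  ((hf.contDiffAt (hU.mem_nhds hp)).differentiableAt (by simp)).hasFDerivAt

theorem chain_gen {f : ℝ → ℝ → ℝ} {g h : ℝ → ℝ} {g' h' t x y : ℝ}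
    {L : ℝ × ℝ →L[ℝ] ℝ} (hf : HasFDerivAt (Function.uncurry f) L (x, y))
    (hgx : g t = x) (hhy : h t = y)
    (hg : HasDerivAt g g' t) (hh : HasDerivAt h h' t) :
    HasDerivAt (fun s => f (g s) (h s)) (L (g', h')) t := by
  subst hgx hhy
  exact hf.comp_hasDerivAt t (hg.prodMk hh)

theorem pdx_fd {U : Set (ℝ × ℝ)} (hU : IsOpen U) {f : ℝ → ℝ → ℝ} (hf : Smooth2 U f) {x y : ℝ}
    (hp : (x, y) ∈ U) : pdx f x y = fderiv ℝ (Function.uncurry f) (x, y) (1, 0) :=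
  (chain_gen (sm_has hU hf hp) rfl rfl (hasDerivAt_id' x) (hasDerivAt_const x y)).deriv

theorem pdy_fd {U : Set (ℝ × ℝ)} (hU : IsOpen U) {f : ℝ → ℝ → ℝ} (hf : Smooth2 U f) {x y : ℝ}
    (hp : (x, y) ∈ U) : pdy f x y = fderiv ℝ (Function.uncurry f) (x, y) (0, 1) :=
  (chain_gen (sm_has hU hf hp) rfl rfl (hasDerivAt_const y x) (hasDerivAt_id' y)).deriv

theorem hasx {U : Set (ℝ × ℝ)} (hU : IsOpen U) {f : ℝ → ℝ → ℝ} (hf : Smooth2 U f) {x y : ℝ}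
    (hp : (x, y) ∈ U) : HasDerivAt (fun t => f t y) (pdx f x y) x := by
  rw [pdx_fd hU hf hp]
  exact chain_gen (sm_has hU hf hp) rfl rfl (hasDerivAt_id' x) (hasDerivAt_const x y)

theorem hasy {U : Set (ℝ × ℝ)} (hU : IsOpen U) {f : ℝ → ℝ → ℝ} (hf : Smooth2 U f) {x y : ℝ}
    (hp : (x, y) ∈ U) : HasDerivAt (fun t => f x t) (pdy f x y) y := by
  rw [pdy_fd hU hf hp]
  exact chain_gen (sm_has hU hf hp) rfl rfl (hasDerivAt_const y x) (hasDerivAt_id' y)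

theorem chain2 {U : Set (ℝ × ℝ)} (hU : IsOpen U) {f : ℝ → ℝ → ℝ} (hf : Smooth2 U f)
    {g h : ℝ → ℝ} {g' h' t : ℝ} (hp : (g t, h t) ∈ U)
    (hg : HasDerivAt g g' t) (hh : HasDerivAt h h' t) :
    HasDerivAt (fun s => f (g s) (h s)) (pdx f (g t) (h t) * g' + pdy f (g t) (h t) * h') t := by
  have := chain_gen (sm_has hU hf hp) rfl rfl hg hh
  convert this using 1
  rw [pdx_fd hU hf hp, pdy_fd hU hf hp]
  have e : ((g', h') : ℝ × ℝ) = g' • (1, 0) + h' • (0, 1) := by simp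
  rw [e, map_add, map_smul, map_smul, smul_eq_mul, smul_eq_mul]
  ring

theorem sm_fd {U : Set (ℝ × ℝ)} (hU : IsOpen U) {f : ℝ → ℝ → ℝ} (hf : Smooth2 U f) (v : ℝ × ℝ) :
    ContDiffOn ℝ (⊤ : ℕ∞) (fun p => fderiv ℝ (Function.uncurry f) p v) U :=
  (hf.fderiv_of_isOpen hU (by simp)).clm_apply contDiffOn_const

theorem sm_pdx {U : Set (ℝ × ℝ)} (hU : IsOpen U) {f : ℝ → ℝ → ℝ} (hf : Smooth2 U f) :
    Smooth2 U (pdx f) :=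
  (sm_fd hU hf (1, 0)).congr (fun p hp => pdx_fd hU hf (x := p.1) (y := p.2) hp)

theorem sm_pdy {U : Set (ℝ × ℝ)} (hU : IsOpen U) {f : ℝ → ℝ → ℝ} (hf : Smooth2 U f) :
    Smooth2 U (pdy f) :=
  (sm_fd hU hf (0, 1)).congr (fun p hp => pdy_fd hU hf (x := p.1) (y := p.2) hp)

theorem sm_mul {U : Set (ℝ × ℝ)} {f g : ℝ → ℝ → ℝ} (hf : Smooth2 U f) (hg : Smooth2 U g) :
    Smooth2 U (fun x y => f x y * g x y) := ContDiffOn.mul hf hg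

theorem sm_sub {U : Set (ℝ × ℝ)} {f g : ℝ → ℝ → ℝ} (hf : Smooth2 U f) (hg : Smooth2 U g) :
    Smooth2 U (fun x y => f x y - g x y) := ContDiffOn.sub hf hg

theorem sm_add {U : Set (ℝ × ℝ)} {f g : ℝ → ℝ → ℝ} (hf : Smooth2 U f) (hg : Smooth2 U g) :
    Smooth2 U (fun x y => f x y + g x y) := ContDiffOn.add hf hg

theorem sm_const {U : Set (ℝ × ℝ)} (c : ℝ) : Smooth2 U (fun _ _ => c) := contDiffOn_const

theorem pd_comm {U : Set (ℝ × ℝ)} (hU : IsOpen U) {f : ℝ → ℝ → ℝ} (hf : Smooth2 U f) {x y : ℝ}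
    (hp : (x, y) ∈ U) : pdx (pdy f) x y = pdy (pdx f) x y := by
  have hc := hf.contDiffAt (hU.mem_nhds hp)
  have hsym : IsSymmSndFDerivAt ℝ (Function.uncurry f) (x, y) :=
    (hc.of_le (m := 2) (by
      change ((2 : ℕ∞) : WithTop ℕ∞) ≤ _
      exact WithTop.coe_le_coe.2 le_top)).isSymmSndFDerivAt (by simp)
  have hd : DifferentiableAt ℝ (fderiv ℝ (Function.uncurry f)) (x, y) :=
    ((hf.fderiv_of_isOpen hU (m := (⊤ : ℕ∞)) (by simp)).contDiffAt
      (hU.mem_nhds hp)).differentiableAt (by simp)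
  have key : ∀ v w : ℝ × ℝ, fderiv ℝ (fun p => fderiv ℝ (Function.uncurry f) p v) (x, y) w
      = fderiv ℝ (fderiv ℝ (Function.uncurry f)) (x, y) w v := by
    intro v w
    rw [fderiv_clm_apply hd (differentiableAt_const v)]
    simp
  have e1 : Function.uncurry (pdy f) =ᶠ[nhds (x, y)]
      fun p => fderiv ℝ (Function.uncurry f) p (0, 1) :=
    Filter.eventually_of_mem (hU.mem_nhds hp)
      (fun p hp => pdy_fd hU hf (x := p.1) (y := p.2) hp)
  have e2 : Function.uncurry (pdx f) =ᶠ[nhds (x, y)]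
      fun p => fderiv ℝ (Function.uncurry f) p (1, 0) :=
    Filter.eventually_of_mem (hU.mem_nhds hp)
      (fun p hp => pdx_fd hU hf (x := p.1) (y := p.2) hp)
  rw [pdx_fd hU (sm_pdy hU hf) hp, pdy_fd hU (sm_pdx hU hf) hp, e1.fderiv_eq, e2.fderiv_eq,
    key, key]
  exact hsym _ _

theorem eqx {U : Set (ℝ × ℝ)} (hU : IsOpen U) {F G : ℝ → ℝ → ℝ}
    (E : ∀ x y : ℝ, (x, y) ∈ U → F x y = G x y) {x y F' G' : ℝ} (hp : (x, y) ∈ U)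
    (hF : HasDerivAt (fun t => F t y) F' x) (hG : HasDerivAt (fun t => G t y) G' x) : F' = G' := by
  have hc : Continuous (fun t : ℝ => (t, y)) := by fun_prop
  have : (fun t => F t y) =ᶠ[nhds x] (fun t => G t y) :=
    Filter.eventually_of_mem ((hU.preimage hc).mem_nhds hp) (fun t ht => E t y ht)
  exact hF.unique (hG.congr_of_eventuallyEq this)

theorem eqy {U : Set (ℝ × ℝ)} (hU : IsOpen U) {F G : ℝ → ℝ → ℝ}
    (E : ∀ x y : ℝ, (x, y) ∈ U → F x y = G x y) {x y F' G' : ℝ} (hp : (x, y) ∈ U)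
    (hF : HasDerivAt (fun t => F x t) F' y) (hG : HasDerivAt (fun t => G x t) G' y) : F' = G' := by
  have hc : Continuous (fun t : ℝ => (x, t)) := by fun_prop
  have : (fun t => F x t) =ᶠ[nhds y] (fun t => G x t) :=
    Filter.eventually_of_mem ((hU.preimage hc).mem_nhds hp) (fun t ht => E x t ht)
  exact hF.unique (hG.congr_of_eventuallyEq this)

/-- Ricci components of the trace-free connection. -/
def K11 (P Q R : ℝ → ℝ → ℝ) : ℝ → ℝ → ℝ := fun x y =>
  pdx Q x y - pdy P x y - 2 * (Q x y * Q x y) + 2 * (P x y * R x y)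

def K12 (P Q R S : ℝ → ℝ → ℝ) : ℝ → ℝ → ℝ := fun x y =>
  pdx R x y - pdy Q x y - Q x y * R x y + P x y * S x y

def K22 (Q R S : ℝ → ℝ → ℝ) : ℝ → ℝ → ℝ := fun x y =>
  pdx S x y - pdy R x y - 2 * (R x y * R x y) + 2 * (S x y * Q x y)

theorem sm_K11 {U : Set (ℝ × ℝ)} (hU : IsOpen U) {P Q R : ℝ → ℝ → ℝ}
    (hP : Smooth2 U P) (hQ : Smooth2 U Q) (hR : Smooth2 U R) : Smooth2 U (K11 P Q R) :=
  sm_add (sm_sub (sm_sub (sm_pdx hU hQ) (sm_pdy hU hP)) (sm_mul (sm_const 2) (sm_mul hQ hQ)))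
    (sm_mul (sm_const 2) (sm_mul hP hR))

theorem sm_K22 {U : Set (ℝ × ℝ)} (hU : IsOpen U) {Q R S : ℝ → ℝ → ℝ}
    (hQ : Smooth2 U Q) (hR : Smooth2 U R) (hS : Smooth2 U S) : Smooth2 U (K22 Q R S) :=
  sm_add (sm_sub (sm_sub (sm_pdx hU hS) (sm_pdy hU hR)) (sm_mul (sm_const 2) (sm_mul hR hR)))
    (sm_mul (sm_const 2) (sm_mul hS hQ))

theorem sm_K12 {U : Set (ℝ × ℝ)} (hU : IsOpen U) {P Q R S : ℝ → ℝ → ℝ}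
    (hP : Smooth2 U P) (hQ : Smooth2 U Q) (hR : Smooth2 U R) (hS : Smooth2 U S) :
    Smooth2 U (K12 P Q R S) :=
  sm_add (sm_sub (sm_sub (sm_pdx hU hR) (sm_pdy hU hQ)) (sm_mul hQ hR)) (sm_mul hP hS)

/-- `A` as a component of the Liouville tensor. -/
theorem coefA_eq {U : Set (ℝ × ℝ)} (hU : IsOpen U) {P Q R S : ℝ → ℝ → ℝ}
    (hP : Smooth2 U P) (hQ : Smooth2 U Q) (hR : Smooth2 U R) (hS : Smooth2 U S)
    {x y : ℝ} (hp : (x, y) ∈ U) :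
    coefA P Q R S x y = pdx (K12 P Q R S) x y - pdy (K11 P Q R) x y
      - Q x y * K12 P Q R S x y + P x y * K22 Q R S x y
      + R x y * K11 P Q R x y - Q x y * K12 P Q R S x y := by
  have X := fun {f : ℝ → ℝ → ℝ} (h : Smooth2 U f) => hasx hU h hp
  have Y := fun {f : ℝ → ℝ → ℝ} (h : Smooth2 U f) => hasy hU h hp
  have h1 : pdx (K12 P Q R S) x y = _ := HasDerivAt.deriv
    ((((X (sm_pdx hU hR)).fun_sub (X (sm_pdy hU hQ))).fun_sub ((X hQ).fun_mul (X hR))).fun_add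
      ((X hP).fun_mul (X hS)))
  have h2 : pdy (K11 P Q R) x y = _ := HasDerivAt.deriv
    ((((Y (sm_pdx hU hQ)).fun_sub (Y (sm_pdy hU hP))).fun_sub
      (((Y hQ).fun_mul (Y hQ)).const_mul 2)).fun_add
      (((Y hP).fun_mul (Y hR)).const_mul 2))
  rw [h1, h2, coefA, K11, K12, K22, pd_comm hU hQ hp]
  ring

theorem coefB_eq {U : Set (ℝ × ℝ)} (hU : IsOpen U) {P Q R S : ℝ → ℝ → ℝ}
    (hP : Smooth2 U P) (hQ : Smooth2 U Q) (hR : Smooth2 U R) (hS : Smooth2 U S)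
    {x y : ℝ} (hp : (x, y) ∈ U) :
    coefB P Q R S x y = pdx (K22 Q R S) x y - pdy (K12 P Q R S) x y
      - R x y * K12 P Q R S x y + Q x y * K22 Q R S x y
      + S x y * K11 P Q R x y - R x y * K12 P Q R S x y := by
  have X := fun {f : ℝ → ℝ → ℝ} (h : Smooth2 U f) => hasx hU h hp
  have Y := fun {f : ℝ → ℝ → ℝ} (h : Smooth2 U f) => hasy hU h hp
  have h1 : pdy (K12 P Q R S) x y = _ := HasDerivAt.deriv
    ((((Y (sm_pdx hU hR)).fun_sub (Y (sm_pdy hU hQ))).fun_sub ((Y hQ).fun_mul (Y hR))).fun_add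
      ((Y hP).fun_mul (Y hS)))
  have h2 : pdx (K22 Q R S) x y = _ := HasDerivAt.deriv
    ((((X (sm_pdx hU hS)).fun_sub (X (sm_pdy hU hR))).fun_sub
      (((X hR).fun_mul (X hR)).const_mul 2)).fun_add
      (((X hS).fun_mul (X hQ)).const_mul 2))
  rw [h1, h2, coefB, K11, K12, K22, pd_comm hU hR hp]
  ring

section core

variable {U Ut : Set (ℝ × ℝ)} {xt yt u v P Q R S Pt Qt Rt St : ℝ → ℝ → ℝ}

/-- The first-order system satisfied by the Jacobian entries. -/
structure CoreSys (U Ut : Set (ℝ × ℝ)) (xt yt u v P Q R S Pt Qt Rt St : ℝ → ℝ → ℝ) : Prop where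
  hU : IsOpen U
  hUt : IsOpen Ut
  hxt : Smooth2 U xt
  hyt : Smooth2 U yt
  hu : Smooth2 U u
  hv : Smooth2 U v
  hP : Smooth2 U P
  hQ : Smooth2 U Q
  hR : Smooth2 U R
  hS : Smooth2 U S
  hPt : Smooth2 Ut Pt
  hQt : Smooth2 Ut Qt
  hRt : Smooth2 Ut Rt
  hSt : Smooth2 Ut St
  hmaps : ∀ x y : ℝ, (x, y) ∈ U → (xt x y, yt x y) ∈ Ut
  hdet : ∀ x y : ℝ, (x, y) ∈ U → pdx xt x y * pdy yt x y - pdy xt x y * pdx yt x y ≠ 0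
  huv : ∀ x y : ℝ, (x, y) ∈ U → pdx v x y = pdy u x y
  E111 : ∀ x y : ℝ, (x, y) ∈ U → pdx (pdx xt) x y =
    pdx xt x y * Q x y - pdy xt x y * P x y
    - (pdx xt x y * pdx xt x y * Qt (xt x y) (yt x y)
      + 2 * (pdx xt x y * pdx yt x y * Rt (xt x y) (yt x y))
      + pdx yt x y * pdx yt x y * St (xt x y) (yt x y))
    + 2 * (pdx xt x y * u x y)
  E211 : ∀ x y : ℝ, (x, y) ∈ U → pdx (pdx yt) x y =
    pdx yt x y * Q x y - pdy yt x y * P x y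
    + (pdx xt x y * pdx xt x y * Pt (xt x y) (yt x y)
      + 2 * (pdx xt x y * pdx yt x y * Qt (xt x y) (yt x y))
      + pdx yt x y * pdx yt x y * Rt (xt x y) (yt x y))
    + 2 * (pdx yt x y * u x y)
  E112 : ∀ x y : ℝ, (x, y) ∈ U → pdy (pdx xt) x y =
    pdx xt x y * R x y - pdy xt x y * Q x y
    - (pdx xt x y * pdy xt x y * Qt (xt x y) (yt x y)
      + (pdx xt x y * pdy yt x y + pdy xt x y * pdx yt x y) * Rt (xt x y) (yt x y)
      + pdx yt x y * pdy yt x y * St (xt x y) (yt x y))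
    + (pdx xt x y * v x y + pdy xt x y * u x y)
  E212 : ∀ x y : ℝ, (x, y) ∈ U → pdy (pdx yt) x y =
    pdx yt x y * R x y - pdy yt x y * Q x y
    + (pdx xt x y * pdy xt x y * Pt (xt x y) (yt x y)
      + (pdx xt x y * pdy yt x y + pdy xt x y * pdx yt x y) * Qt (xt x y) (yt x y)
      + pdx yt x y * pdy yt x y * Rt (xt x y) (yt x y))
    + (pdx yt x y * v x y + pdy yt x y * u x y)
  E122 : ∀ x y : ℝ, (x, y) ∈ U → pdy (pdy xt) x y =
    pdx xt x y * S x y - pdy xt x y * R x y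
    - (pdy xt x y * pdy xt x y * Qt (xt x y) (yt x y)
      + 2 * (pdy xt x y * pdy yt x y * Rt (xt x y) (yt x y))
      + pdy yt x y * pdy yt x y * St (xt x y) (yt x y))
    + 2 * (pdy xt x y * v x y)
  E222 : ∀ x y : ℝ, (x, y) ∈ U → pdy (pdy yt) x y =
    pdx yt x y * S x y - pdy yt x y * R x y
    + (pdy xt x y * pdy xt x y * Pt (xt x y) (yt x y)
      + 2 * (pdy xt x y * pdy yt x y * Qt (xt x y) (yt x y))
      + pdy yt x y * pdy yt x y * Rt (xt x y) (yt x y))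
    + 2 * (pdy yt x y * v x y)

theorem ricci_rule (H : CoreSys U Ut xt yt u v P Q R S Pt Qt Rt St) :
    ∀ x y : ℝ, (x, y) ∈ U → (K11 P Q R x y =
      pdx xt x y * pdx xt x y * K11 Pt Qt Rt (xt x y) (yt x y)
      + 2 * (pdx xt x y * pdx yt x y * K12 Pt Qt Rt St (xt x y) (yt x y))
      + pdx yt x y * pdx yt x y * K22 Qt Rt St (xt x y) (yt x y)
      + (pdx u x y - Q x y * u x y + P x y * v x y - u x y * u x y)) ∧
    (K12 P Q R S x y =
      pdx xt x y * pdy xt x y * K11 Pt Qt Rt (xt x y) (yt x y)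
      + (pdx xt x y * pdy yt x y + pdy xt x y * pdx yt x y) * K12 Pt Qt Rt St (xt x y) (yt x y)
      + pdx yt x y * pdy yt x y * K22 Qt Rt St (xt x y) (yt x y)
      + (pdy u x y - R x y * u x y + Q x y * v x y - u x y * v x y)) ∧
    (K22 Q R S x y =
      pdy xt x y * pdy xt x y * K11 Pt Qt Rt (xt x y) (yt x y)
      + 2 * (pdy xt x y * pdy yt x y * K12 Pt Qt Rt St (xt x y) (yt x y))
      + pdy yt x y * pdy yt x y * K22 Qt Rt St (xt x y) (yt x y)
      + (pdy v x y - S x y * u x y + R x y * v x y - v x y * v x y)) := by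
  obtain ⟨hU, hUt, hxt, hyt, hu, hv, hP, hQ, hR, hS, hPt, hQt, hRt, hSt, hmaps, hdet, huv,
    E111, E211, E112, E212, E122, E222⟩ := H
  intro x y hp
  have X := fun {f : ℝ → ℝ → ℝ} (h : Smooth2 U f) => hasx hU h hp
  have Y := fun {f : ℝ → ℝ → ℝ} (h : Smooth2 U f) => hasy hU h hp
  have CX := fun {f : ℝ → ℝ → ℝ} (h : Smooth2 Ut f) =>
    chain2 hUt h (g := fun t => xt t y) (h := fun t => yt t y) (hmaps x y hp) (X hxt) (X hyt)
  have CY := fun {f : ℝ → ℝ → ℝ} (h : Smooth2 Ut f) =>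
    chain2 hUt h (g := fun t => xt x t) (h := fun t => yt x t) (hmaps x y hp) (Y hxt) (Y hyt)
  have sa := sm_pdx hU hxt
  have sb := sm_pdy hU hxt
  have sc := sm_pdx hU hyt
  have sd := sm_pdy hU hyt
  have F111 := eqy hU E111 hp (Y (sm_pdx hU sa))
    (((((Y sa).fun_mul (Y hQ)).fun_sub ((Y sb).fun_mul (Y hP))).fun_sub
      (((((Y sa).fun_mul (Y sa)).fun_mul (CY hQt)).fun_add
        ((((Y sa).fun_mul (Y sc)).fun_mul (CY hRt)).const_mul 2)).fun_add
        (((Y sc).fun_mul (Y sc)).fun_mul (CY hSt)))).fun_add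
      (((Y sa).fun_mul (Y hu)).const_mul 2))
  have F211 := eqy hU E211 hp (Y (sm_pdx hU sc))
    (((((Y sc).fun_mul (Y hQ)).fun_sub ((Y sd).fun_mul (Y hP))).fun_add
      (((((Y sa).fun_mul (Y sa)).fun_mul (CY hPt)).fun_add
        ((((Y sa).fun_mul (Y sc)).fun_mul (CY hQt)).const_mul 2)).fun_add
        (((Y sc).fun_mul (Y sc)).fun_mul (CY hRt)))).fun_add
      (((Y sc).fun_mul (Y hu)).const_mul 2))
  have F122 := eqx hU E122 hp (X (sm_pdy hU sb))
    (((((X sa).fun_mul (X hS)).fun_sub ((X sb).fun_mul (X hR))).fun_sub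
      (((((X sb).fun_mul (X sb)).fun_mul (CX hQt)).fun_add
        ((((X sb).fun_mul (X sd)).fun_mul (CX hRt)).const_mul 2)).fun_add
        (((X sd).fun_mul (X sd)).fun_mul (CX hSt)))).fun_add
      (((X sb).fun_mul (X hv)).const_mul 2))
  have F222 := eqx hU E222 hp (X (sm_pdy hU sd))
    (((((X sc).fun_mul (X hS)).fun_sub ((X sd).fun_mul (X hR))).fun_add
      (((((X sb).fun_mul (X sb)).fun_mul (CX hPt)).fun_add
        ((((X sb).fun_mul (X sd)).fun_mul (CX hQt)).const_mul 2)).fun_add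
        (((X sd).fun_mul (X sd)).fun_mul (CX hRt)))).fun_add
      (((X sd).fun_mul (X hv)).const_mul 2))
  have F112x := eqx hU E112 hp (X (sm_pdy hU sa))
    (((((X sa).fun_mul (X hR)).fun_sub ((X sb).fun_mul (X hQ))).fun_sub
      (((((X sa).fun_mul (X sb)).fun_mul (CX hQt)).fun_add
        ((((X sa).fun_mul (X sd)).fun_add ((X sb).fun_mul (X sc))).fun_mul (CX hRt))).fun_add
        (((X sc).fun_mul (X sd)).fun_mul (CX hSt)))).fun_add
      (((X sa).fun_mul (X hv)).fun_add ((X sb).fun_mul (X hu))))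
  have F212x := eqx hU E212 hp (X (sm_pdy hU sc))
    (((((X sc).fun_mul (X hR)).fun_sub ((X sd).fun_mul (X hQ))).fun_add
      (((((X sa).fun_mul (X sb)).fun_mul (CX hPt)).fun_add
        ((((X sa).fun_mul (X sd)).fun_add ((X sb).fun_mul (X sc))).fun_mul (CX hQt))).fun_add
        (((X sc).fun_mul (X sd)).fun_mul (CX hRt)))).fun_add
      (((X sc).fun_mul (X hv)).fun_add ((X sd).fun_mul (X hu))))
  have F112y := eqy hU E112 hp (Y (sm_pdy hU sa))
    (((((Y sa).fun_mul (Y hR)).fun_sub ((Y sb).fun_mul (Y hQ))).fun_sub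
      (((((Y sa).fun_mul (Y sb)).fun_mul (CY hQt)).fun_add
        ((((Y sa).fun_mul (Y sd)).fun_add ((Y sb).fun_mul (Y sc))).fun_mul (CY hRt))).fun_add
        (((Y sc).fun_mul (Y sd)).fun_mul (CY hSt)))).fun_add
      (((Y sa).fun_mul (Y hv)).fun_add ((Y sb).fun_mul (Y hu))))
  have F212y := eqy hU E212 hp (Y (sm_pdy hU sc))
    (((((Y sc).fun_mul (Y hR)).fun_sub ((Y sd).fun_mul (Y hQ))).fun_add
      (((((Y sa).fun_mul (Y sb)).fun_mul (CY hPt)).fun_add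
        ((((Y sa).fun_mul (Y sd)).fun_add ((Y sb).fun_mul (Y sc))).fun_mul (CY hQt))).fun_add
        (((Y sc).fun_mul (Y sd)).fun_mul (CY hRt)))).fun_add
      (((Y sc).fun_mul (Y hv)).fun_add ((Y sd).fun_mul (Y hu))))
  -- commutation
  have c1 := pd_comm hU sa hp
  have c2 := pd_comm hU sc hp
  have c3 : pdx (pdy (pdy xt)) x y = pdy (pdy (pdx xt)) x y := by
    rw [pd_comm hU sb hp]
    exact eqy hU (fun x y hp => pd_comm hU hxt hp) hp (Y (sm_pdx hU sb)) (Y (sm_pdy hU sa))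
  have c4 : pdx (pdy (pdy yt)) x y = pdy (pdy (pdx yt)) x y := by
    rw [pd_comm hU sd hp]
    exact eqy hU (fun x y hp => pd_comm hU hyt hp) hp (Y (sm_pdx hU sd)) (Y (sm_pdy hU sc))
  rw [F111, F112x] at c1
  rw [F211, F212x] at c2
  rw [F122, F112y] at c3
  rw [F222, F212y] at c4
  clear F111 F211 F122 F222 F112x F112y F212x F212y
  simp only [pd_comm hU hxt hp, pd_comm hU hyt hp, huv x y hp, E111 x y hp, E211 x y hp,
    E112 x y hp, E212 x y hp, E122 x y hp, E222 x y hp] at c1 c2 c3 c4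

  have hD := hdet x y hp
  clear E111 E211 E112 E212 E122 E222
  simp only [K11, K12, K22]
  refine ⟨mul_left_cancel₀ hD ?_, mul_left_cancel₀ hD ?_, mul_left_cancel₀ hD ?_⟩
  · linear_combination pdx yt x y * c1 - pdx xt x y * c2
  · linear_combination pdy yt x y * c1 - pdy xt x y * c2
  · linear_combination pdy yt x y * c3 - pdy xt x y * c4

theorem liouville_rule (H : CoreSys U Ut xt yt u v P Q R S Pt Qt Rt St) :
    ∀ x y : ℝ, (x, y) ∈ U →
      coefA P Q R S x y = (pdx xt x y * pdy yt x y - pdy xt x y * pdx yt x y) *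
        (pdx xt x y * coefA Pt Qt Rt St (xt x y) (yt x y)
          + pdx yt x y * coefB Pt Qt Rt St (xt x y) (yt x y)) ∧
      coefB P Q R S x y = (pdx xt x y * pdy yt x y - pdy xt x y * pdx yt x y) *
        (pdy xt x y * coefA Pt Qt Rt St (xt x y) (yt x y)
          + pdy yt x y * coefB Pt Qt Rt St (xt x y) (yt x y)) := by
  have hK := ricci_rule H
  obtain ⟨hU, hUt, hxt, hyt, hu, hv, hP, hQ, hR, hS, hPt, hQt, hRt, hSt, hmaps, hdet, huv,
    E111, E211, E112, E212, E122, E222⟩ := H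
  intro x y hp
  have X := fun {f : ℝ → ℝ → ℝ} (h : Smooth2 U f) => hasx hU h hp
  have Y := fun {f : ℝ → ℝ → ℝ} (h : Smooth2 U f) => hasy hU h hp
  have CX := fun {f : ℝ → ℝ → ℝ} (h : Smooth2 Ut f) =>
    chain2 hUt h (g := fun t => xt t y) (h := fun t => yt t y) (hmaps x y hp) (X hxt) (X hyt)
  have CY := fun {f : ℝ → ℝ → ℝ} (h : Smooth2 Ut f) =>
    chain2 hUt h (g := fun t => xt x t) (h := fun t => yt x t) (hmaps x y hp) (Y hxt) (Y hyt)
  have sa := sm_pdx hU hxt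
  have sb := sm_pdy hU hxt
  have sc := sm_pdx hU hyt
  have sd := sm_pdy hU hyt
  have k11 := sm_K11 hUt hPt hQt hRt
  have k12 := sm_K12 hUt hPt hQt hRt hSt
  have k22 := sm_K22 hUt hQt hRt hSt
  have G11 := eqy hU (fun x y hp => (hK x y hp).1) hp (Y (sm_K11 hU hP hQ hR))
    (((((Y sa).fun_mul (Y sa)).fun_mul (CY k11)).fun_add
      ((((Y sa).fun_mul (Y sc)).fun_mul (CY k12)).const_mul 2)).fun_add
      (((Y sc).fun_mul (Y sc)).fun_mul (CY k22)) |>.fun_add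
      ((((Y (sm_pdx hU hu)).fun_sub ((Y hQ).fun_mul (Y hu))).fun_add
        ((Y hP).fun_mul (Y hv))).fun_sub ((Y hu).fun_mul (Y hu))))
  have G12y := eqy hU (fun x y hp => (hK x y hp).2.1) hp (Y (sm_K12 hU hP hQ hR hS))
    (((((Y sa).fun_mul (Y sb)).fun_mul (CY k11)).fun_add
      ((((Y sa).fun_mul (Y sd)).fun_add ((Y sb).fun_mul (Y sc))).fun_mul (CY k12))).fun_add
      (((Y sc).fun_mul (Y sd)).fun_mul (CY k22)) |>.fun_add
      ((((Y (sm_pdy hU hu)).fun_sub ((Y hR).fun_mul (Y hu))).fun_add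
        ((Y hQ).fun_mul (Y hv))).fun_sub ((Y hu).fun_mul (Y hv))))
  have G12x := eqx hU (fun x y hp => (hK x y hp).2.1) hp (X (sm_K12 hU hP hQ hR hS))
    (((((X sa).fun_mul (X sb)).fun_mul (CX k11)).fun_add
      ((((X sa).fun_mul (X sd)).fun_add ((X sb).fun_mul (X sc))).fun_mul (CX k12))).fun_add
      (((X sc).fun_mul (X sd)).fun_mul (CX k22)) |>.fun_add
      ((((X (sm_pdy hU hu)).fun_sub ((X hR).fun_mul (X hu))).fun_add
        ((X hQ).fun_mul (X hv))).fun_sub ((X hu).fun_mul (X hv))))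
  have G22 := eqx hU (fun x y hp => (hK x y hp).2.2) hp (X (sm_K22 hU hQ hR hS))
    (((((X sb).fun_mul (X sb)).fun_mul (CX k11)).fun_add
      ((((X sb).fun_mul (X sd)).fun_mul (CX k12)).const_mul 2)).fun_add
      (((X sd).fun_mul (X sd)).fun_mul (CX k22)) |>.fun_add
      ((((X (sm_pdy hU hv)).fun_sub ((X hS).fun_mul (X hu))).fun_add
        ((X hR).fun_mul (X hv))).fun_sub ((X hv).fun_mul (X hv))))
  have cu := pd_comm hU hu hp
  have cv : pdx (pdy v) x y = pdy (pdy u) x y := by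
    rw [pd_comm hU hv hp]
    exact eqy hU huv hp (Y (sm_pdx hU hv)) (Y (sm_pdy hU hu))
  obtain ⟨K1, K2, K3⟩ := hK x y hp
  -- Ricci components written out, used to eliminate first derivatives of the coefficients
  have D1 : pdx Q x y = K11 P Q R x y + pdy P x y + 2 * (Q x y * Q x y) - 2 * (P x y * R x y) := by
    simp only [K11]; ring
  have D2 : pdx R x y = K12 P Q R S x y + pdy Q x y + Q x y * R x y - P x y * S x y := by
    simp only [K12]; ring
  have D3 : pdx S x y = K22 Q R S x y + pdy R x y + 2 * (R x y * R x y) - 2 * (S x y * Q x y) := by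
    simp only [K22]; ring
  rw [coefA_eq hU hP hQ hR hS hp, coefB_eq hU hP hQ hR hS hp,
    coefA_eq hUt hPt hQt hRt hSt (hmaps x y hp), coefB_eq hUt hPt hQt hRt hSt (hmaps x y hp),
    G11, G12x, G12y, G22]
  clear G11 G12x G12y G22
  simp only [cu, cv, pd_comm hU hxt hp, pd_comm hU hyt hp, huv x y hp, E111 x y hp, E211 x y hp,
      E112 x y hp, E212 x y hp, E122 x y hp, E222 x y hp, D1, D2, D3, K1, K2, K3]
  constructor <;> ring

end core

/-- Solve the transformation rule for the second derivatives. -/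
theorem rule_solve (a b c d t0 t1 n0 n1 e0 e1 z0 z1 : ℝ) (hD : a * d - b * c ≠ 0)
    (h0 : t0 = d / (a * d - b * c) * n0 + -b / (a * d - b * c) * n1
      + (d / (a * d - b * c) * e0 + -b / (a * d - b * c) * e1) - z0)
    (h1 : t1 = -c / (a * d - b * c) * n0 + a / (a * d - b * c) * n1
      + (-c / (a * d - b * c) * e0 + a / (a * d - b * c) * e1) - z1) :
    e0 = a * t0 + b * t1 - n0 + (a * z0 + b * z1) ∧
    e1 = c * t0 + d * t1 - n1 + (c * z0 + d * z1) := by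
  have hI := mul_inv_cancel₀ hD
  simp only [div_eq_mul_inv] at h0 h1
  generalize (a * d - b * c)⁻¹ = I at hI h0 h1
  subst h0 h1
  exact ⟨by linear_combination (-(n0 + e0)) * hI, by linear_combination (-(n1 + e1)) * hI⟩

/-- The pair `α = (B, −A)` is pseudovectorial of weight 2. -/
theorem alpha_pseudovectorial_weight_two
    (U Ut : Set (ℝ × ℝ)) (hU : IsOpen U) (hUconn : IsConnected U) (hUt : IsOpen Ut)
    (xt yt : ℝ → ℝ → ℝ) (hxt : Smooth2 U xt) (hyt : Smooth2 U yt)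
    (hmaps : ∀ x y : ℝ, (x, y) ∈ U → (xt x y, yt x y) ∈ Ut)
    (hdet : ∀ x y : ℝ, (x, y) ∈ U → Jdet xt yt x y ≠ 0)
    (P Q R S Pt Qt Rt St : ℝ → ℝ → ℝ)
    (hP : Smooth2 U P) (hQ : Smooth2 U Q) (hR : Smooth2 U R) (hS : Smooth2 U S)
    (hPt : Smooth2 Ut Pt) (hQt : Smooth2 Ut Qt) (hRt : Smooth2 Ut Rt) (hSt : Smooth2 Ut St)
    (hrel : PointRelated U xt yt P Q R S Pt Qt Rt St) :
    ∀ x y : ℝ, (x, y) ∈ U →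
      coefB P Q R S x y =
        (Jdet xt yt x y)^2 *
          (Jinv xt yt 0 0 x y * coefB Pt Qt Rt St (xt x y) (yt x y)
            - Jinv xt yt 0 1 x y * coefA Pt Qt Rt St (xt x y) (yt x y)) ∧
      -(coefA P Q R S x y) =
        (Jdet xt yt x y)^2 *
          (Jinv xt yt 1 0 x y * coefB Pt Qt Rt St (xt x y) (yt x y)
            - Jinv xt yt 1 1 x y * coefA Pt Qt Rt St (xt x y) (yt x y)) := by
  have sa := sm_pdx hU hxt
  have sb := sm_pdy hU hxt
  have sc := sm_pdx hU hyt
  have sd := sm_pdy hU hyt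
  have sD : Smooth2 U (Jdet xt yt) := sm_sub (sm_mul sa sd) (sm_mul sb sc)
  have hu : Smooth2 U (fun x y => sigmaT xt yt 0 x y / 3) :=
    ((sm_pdx hU sD).div sD (fun p hp => hdet p.1 p.2 hp)).div_const 3
  have hv : Smooth2 U (fun x y => sigmaT xt yt 1 x y / 3) :=
    ((sm_pdy hU sD).div sD (fun p hp => hdet p.1 p.2 hp)).div_const 3
  have eu : ∀ x y : ℝ, (x, y) ∈ U →
      pdx (Jdet xt yt) x y = 3 * (Jdet xt yt x y * (sigmaT xt yt 0 x y / 3)) := by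
    intro x y hp
    have := hdet x y hp
    simp only [sigmaT, pd, if_true]
    field_simp
  have ev : ∀ x y : ℝ, (x, y) ∈ U →
      pdy (Jdet xt yt) x y = 3 * (Jdet xt yt x y * (sigmaT xt yt 1 x y / 3)) := by
    intro x y hp
    have := hdet x y hp
    simp only [sigmaT, pd, one_ne_zero, if_false]
    field_simp
  have huv : ∀ x y : ℝ, (x, y) ∈ U → pdx (fun x y => sigmaT xt yt 1 x y / 3) x y
      = pdy (fun x y => sigmaT xt yt 0 x y / 3) x y := by
    intro x y hp
    have h1 := eqy hU eu hp (hasy hU (sm_pdx hU sD) hp)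
      (((hasy hU sD hp).fun_mul (hasy hU hu hp)).const_mul 3)
    have h2 := eqx hU ev hp (hasx hU (sm_pdy hU sD) hp)
      (((hasx hU sD hp).fun_mul (hasx hU hv hp)).const_mul 3)
    rw [pd_comm hU sD hp, h1, eu x y hp, ev x y hp] at h2
    apply mul_left_cancel₀ (hdet x y hp)
    linear_combination (-1 / 3) * h2
  have hdet' : ∀ x y : ℝ, (x, y) ∈ U →
      pdx xt x y * pdy yt x y - pdy xt x y * pdx yt x y ≠ 0 := hdet
  have sol : ∀ (i j : Fin 2) (x y : ℝ), (x, y) ∈ U → _ := fun i j x y hp =>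
    And.intro (hrel i j 0 x y hp) (hrel i j 1 x y hp)
  simp only [Fin.sum_univ_two, Jinv, Jdet, Jmat, pd] at sol
  have r11 := sol 0 0
  have r12 := sol 0 1
  have r22 := sol 1 1
  clear sol
  simp [thetaUp, thetaLow] at r11 r12 r22
  have H : CoreSys U Ut xt yt (fun x y => sigmaT xt yt 0 x y / 3)
      (fun x y => sigmaT xt yt 1 x y / 3) P Q R S Pt Qt Rt St := by
    refine ⟨hU, hUt, hxt, hyt, hu, hv, hP, hQ, hR, hS, hPt, hQt, hRt, hSt, hmaps, hdet', huv,
      ?_, ?_, ?_, ?_, ?_, ?_⟩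
    · intro x y hp
      have h := r11 x y hp
      have := (rule_solve (pdx xt x y) (pdy xt x y) (pdx yt x y) (pdy yt x y) (Q x y) (-P x y)
        (pdx xt x y * pdx xt x y * (Qt (xt x y) (yt x y)) + pdx xt x y * pdx yt x y * (Rt (xt x y) (yt x y)) + pdx yt x y * pdx xt x y * (Rt (xt x y) (yt x y)) + pdx yt x y * pdx yt x y * (St (xt x y) (yt x y)))
        (-(pdx xt x y * pdx xt x y * (Pt (xt x y) (yt x y)) + pdx xt x y * pdx yt x y * (Qt (xt x y) (yt x y)) + pdx yt x y * pdx xt x y * (Qt (xt x y) (yt x y)) + pdx yt x y * pdx yt x y * (Rt (xt x y) (yt x y))))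
        (pdx (pdx xt) x y) (pdx (pdx yt) x y) (2 * (sigmaT xt yt 0 x y / 3)) 0
        (hdet' x y hp) (by linear_combination h.1) (by linear_combination h.2)).1
      linear_combination this
    · intro x y hp
      have h := r11 x y hp
      have := (rule_solve (pdx xt x y) (pdy xt x y) (pdx yt x y) (pdy yt x y) (Q x y) (-P x y)
        (pdx xt x y * pdx xt x y * (Qt (xt x y) (yt x y)) + pdx xt x y * pdx yt x y * (Rt (xt x y) (yt x y)) + pdx yt x y * pdx xt x y * (Rt (xt x y) (yt x y)) + pdx yt x y * pdx yt x y * (St (xt x y) (yt x y)))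
        (-(pdx xt x y * pdx xt x y * (Pt (xt x y) (yt x y)) + pdx xt x y * pdx yt x y * (Qt (xt x y) (yt x y)) + pdx yt x y * pdx xt x y * (Qt (xt x y) (yt x y)) + pdx yt x y * pdx yt x y * (Rt (xt x y) (yt x y))))
        (pdx (pdx xt) x y) (pdx (pdx yt) x y) (2 * (sigmaT xt yt 0 x y / 3)) 0
        (hdet' x y hp) (by linear_combination h.1) (by linear_combination h.2)).2
      linear_combination this
    · intro x y hp
      have h := r12 x y hp
      have := (rule_solve (pdx xt x y) (pdy xt x y) (pdx yt x y) (pdy yt x y) (R x y) (-Q x y)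
        (pdx xt x y * pdy xt x y * (Qt (xt x y) (yt x y)) + pdx xt x y * pdy yt x y * (Rt (xt x y) (yt x y)) + pdx yt x y * pdy xt x y * (Rt (xt x y) (yt x y)) + pdx yt x y * pdy yt x y * (St (xt x y) (yt x y)))
        (-(pdx xt x y * pdy xt x y * (Pt (xt x y) (yt x y)) + pdx xt x y * pdy yt x y * (Qt (xt x y) (yt x y)) + pdx yt x y * pdy xt x y * (Qt (xt x y) (yt x y)) + pdx yt x y * pdy yt x y * (Rt (xt x y) (yt x y))))
        (pdy (pdx xt) x y) (pdy (pdx yt) x y) (sigmaT xt yt 1 x y / 3) (sigmaT xt yt 0 x y / 3)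
        (hdet' x y hp) (by linear_combination h.1) (by linear_combination h.2)).1
      linear_combination this
    · intro x y hp
      have h := r12 x y hp
      have := (rule_solve (pdx xt x y) (pdy xt x y) (pdx yt x y) (pdy yt x y) (R x y) (-Q x y)
        (pdx xt x y * pdy xt x y * (Qt (xt x y) (yt x y)) + pdx xt x y * pdy yt x y * (Rt (xt x y) (yt x y)) + pdx yt x y * pdy xt x y * (Rt (xt x y) (yt x y)) + pdx yt x y * pdy yt x y * (St (xt x y) (yt x y)))
        (-(pdx xt x y * pdy xt x y * (Pt (xt x y) (yt x y)) + pdx xt x y * pdy yt x y * (Qt (xt x y) (yt x y)) + pdx yt x y * pdy xt x y * (Qt (xt x y) (yt x y)) + pdx yt x y * pdy yt x y * (Rt (xt x y) (yt x y))))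
        (pdy (pdx xt) x y) (pdy (pdx yt) x y) (sigmaT xt yt 1 x y / 3) (sigmaT xt yt 0 x y / 3)
        (hdet' x y hp) (by linear_combination h.1) (by linear_combination h.2)).2
      linear_combination this
    · intro x y hp
      have h := r22 x y hp
      have := (rule_solve (pdx xt x y) (pdy xt x y) (pdx yt x y) (pdy yt x y) (S x y) (-R x y)
        (pdy xt x y * pdy xt x y * (Qt (xt x y) (yt x y)) + pdy xt x y * pdy yt x y * (Rt (xt x y) (yt x y)) + pdy yt x y * pdy xt x y * (Rt (xt x y) (yt x y)) + pdy yt x y * pdy yt x y * (St (xt x y) (yt x y)))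
        (-(pdy xt x y * pdy xt x y * (Pt (xt x y) (yt x y)) + pdy xt x y * pdy yt x y * (Qt (xt x y) (yt x y)) + pdy yt x y * pdy xt x y * (Qt (xt x y) (yt x y)) + pdy yt x y * pdy yt x y * (Rt (xt x y) (yt x y))))
        (pdy (pdy xt) x y) (pdy (pdy yt) x y) 0 (2 * (sigmaT xt yt 1 x y / 3))
        (hdet' x y hp) (by linear_combination h.1) (by linear_combination h.2)).1
      linear_combination this
    · intro x y hp
      have h := r22 x y hp
      have := (rule_solve (pdx xt x y) (pdy xt x y) (pdx yt x y) (pdy yt x y) (S x y) (-R x y)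
        (pdy xt x y * pdy xt x y * (Qt (xt x y) (yt x y)) + pdy xt x y * pdy yt x y * (Rt (xt x y) (yt x y)) + pdy yt x y * pdy xt x y * (Rt (xt x y) (yt x y)) + pdy yt x y * pdy yt x y * (St (xt x y) (yt x y)))
        (-(pdy xt x y * pdy xt x y * (Pt (xt x y) (yt x y)) + pdy xt x y * pdy yt x y * (Qt (xt x y) (yt x y)) + pdy yt x y * pdy xt x y * (Qt (xt x y) (yt x y)) + pdy yt x y * pdy yt x y * (Rt (xt x y) (yt x y))))
        (pdy (pdy xt) x y) (pdy (pdy yt) x y) 0 (2 * (sigmaT xt yt 1 x y / 3))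
        (hdet' x y hp) (by linear_combination h.1) (by linear_combination h.2)).2
      linear_combination this
  intro x y hp
  obtain ⟨hA, hB⟩ := liouville_rule H x y hp
  have hD := hdet' x y hp
  rw [hA, hB]
  simp only [Jinv, Jdet, Jmat, pd]
  simp only [if_true, one_ne_zero, if_false]
  constructor <;> (field_simp; ring)
end
end

section
/- If the coefficient systems (P,Q,R,S) on U and (P̃,Q̃,R̃,S̃) on Ũ are related by the point-transformation rule via φ, then the pair β = (G, H) is pseudovectorial of weight 4: at every point of U, G = (det T)⁴·(S¹₁·(G̃∘φ) + S¹₂·(H̃∘φ)) and H = (det T)⁴·(S²₁·(G̃∘φ) + S²₂·(H̃∘φ)). -/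
noncomputable section

open Real

/-- The quantity `G` of formula (2.4). -/
def coefG (P Q R S : ℝ → ℝ → ℝ) : ℝ → ℝ → ℝ := fun x y =>
  -(coefB P Q R S x y) * pdx (coefB P Q R S) x y
    - 3 * coefA P Q R S x y * pdy (coefB P Q R S) x y
    + 4 * coefB P Q R S x y * pdy (coefA P Q R S) x y
    + 3 * S x y * (coefA P Q R S x y)^2
    - 6 * R x y * coefA P Q R S x y * coefB P Q R S x y
    + 3 * Q x y * (coefB P Q R S x y)^2

/-- The quantity `H` of formula (2.4). -/
def coefH (P Q R S : ℝ → ℝ → ℝ) : ℝ → ℝ → ℝ := fun x y =>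
  -(coefA P Q R S x y) * pdy (coefA P Q R S) x y
    - 3 * coefB P Q R S x y * pdx (coefA P Q R S) x y
    + 4 * coefA P Q R S x y * pdx (coefB P Q R S) x y
    - 3 * P x y * (coefB P Q R S x y)^2
    + 6 * Q x y * coefA P Q R S x y * coefB P Q R S x y
    - 3 * R x y * (coefA P Q R S x y)^2

/-- The quantity `F⁵` of formula (2.2). -/
def coefF5 (P Q R S : ℝ → ℝ → ℝ) : ℝ → ℝ → ℝ := fun x y =>
  coefA P Q R S x y * coefB P Q R S x y * pdy (coefA P Q R S) x y
    + coefA P Q R S x y * coefB P Q R S x y * pdx (coefB P Q R S) x y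
    - (coefA P Q R S x y)^2 * pdy (coefB P Q R S) x y
    - (coefB P Q R S x y)^2 * pdx (coefA P Q R S) x y
    - P x y * (coefB P Q R S x y)^3
    + 3 * Q x y * coefA P Q R S x y * (coefB P Q R S x y)^2
    - 3 * R x y * (coefA P Q R S x y)^2 * coefB P Q R S x y
    + S x y * (coefA P Q R S x y)^3

theorem der_two {A : Type*} [CommRing A] [Algebra ℝ A] (D : Derivation ℝ A A) :
    D 2 = 0 := by
  exact_mod_cast D.map_natCast 2

theorem der_three {A : Type*} [CommRing A] [Algebra ℝ A] (D : Derivation ℝ A A) :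
    D 3 = 0 := by
  exact_mod_cast D.map_natCast 3

set_option maxHeartbeats 4000000 in
/-- Compatibility of the structure equations for the Jacobian: derivatives of `σ`. -/
theorem alg_sigma {A : Type*} [CommRing A] [Algebra ℝ A] (Dx Dy : Derivation ℝ A A)
    (hcomm : ∀ f, Dy (Dx f) = Dx (Dy f))
    (a b c d e s1 s2 P Q R S p q r s px py qx qy rx ry sx sy : A)
    (he : e * (a * d - b * c) = 1)
    (hxa : Dx a = a * Q - b * P - (q * a * a + 2 * r * a * c + s * c * c) + 2 * s1 * a)
    (hya : Dy a = a * R - b * Q - (q * a * b + r * (a * d + b * c) + s * c * d) + s1 * b + s2 * a)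
    (hxb : Dx b = a * R - b * Q - (q * a * b + r * (a * d + b * c) + s * c * d) + s1 * b + s2 * a)
    (hyb : Dy b = a * S - b * R - (q * b * b + 2 * r * b * d + s * d * d) + 2 * s2 * b)
    (hxc : Dx c = c * Q - d * P + (p * a * a + 2 * q * a * c + r * c * c) + 2 * s1 * c)
    (hyc : Dy c = c * R - d * Q + (p * a * b + q * (a * d + b * c) + r * c * d) + s1 * d + s2 * c)
    (hxd : Dx d = c * R - d * Q + (p * a * b + q * (a * d + b * c) + r * c * d) + s1 * d + s2 * c)
    (hyd : Dy d = c * S - d * R + (p * b * b + 2 * q * b * d + r * d * d) + 2 * s2 * d)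
    (hcurl : Dx s2 = Dy s1)
    (hxp : Dx p = px * a + py * c) (hyp : Dy p = px * b + py * d)
    (hxq : Dx q = qx * a + qy * c) (hyq : Dy q = qx * b + qy * d)
    (hxr : Dx r = rx * a + ry * c) (hyr : Dy r = rx * b + ry * d)
    (hxs : Dx s = sx * a + sy * c) (hys : Dy s = sx * b + sy * d)
    (m11 m12 m22 n11 n12 n22 : A)
    (hm11 : m11 = Dx Q - Dy P - 2 * Q * Q + 2 * P * R)
    (hm12 : m12 = Dx R - Dy Q - Q * R + P * S)
    (hm22 : m22 = Dx S - Dy R - 2 * R * R + 2 * Q * S)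
    (hn11 : n11 = qx - py - 2 * q * q + 2 * p * r)
    (hn12 : n12 = rx - qy - q * r + p * s)
    (hn22 : n22 = sx - ry - 2 * r * r + 2 * q * s) :
    Dx s1 = s1 * s1 + Q * s1 - P * s2 + m11
      - (n11 * a * a + 2 * n12 * a * c + n22 * c * c) ∧
    Dy s1 = s1 * s2 + R * s1 - Q * s2 + m12
      - (n11 * a * b + n12 * (a * d + b * c) + n22 * c * d) ∧
    Dy s2 = s2 * s2 + S * s1 - R * s2 + m22
      - (n11 * b * b + 2 * n12 * b * d + n22 * d * d) := by
  have e1 := hcomm a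
  have e2 := hcomm c
  have e3 := hcomm b
  have e4 := hcomm d
  rw [hxa, hya] at e1
  rw [hxc, hyc] at e2
  rw [hxb, hyb] at e3
  rw [hxd, hyd] at e4
  simp only [map_add, map_sub, Derivation.leibniz, smul_eq_mul, der_two, hxa, hya, hxb, hyb, hxc, hyc,
    hxd, hyd, hxp, hyp, hxq, hyq, hxr, hyr, hxs, hys, hcurl] at e1 e2 e3 e4
  refine ⟨?_, ?_, ?_⟩
  · linear_combination (exp := 1) e * (c * e1 - a * e2)
      - he * (Dx s1 - (s1 * s1 + Q * s1 - P * s2 + m11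
      - (n11 * a * a + 2 * n12 * a * c + n22 * c * c)))
      - e * (a * d - b * c) * (hm11 - (hn11 * a * a + 2 * hn12 * a * c + hn22 * c * c))
  · linear_combination (exp := 1) e * (d * e1 - b * e2)
      - he * (Dy s1 - (s1 * s2 + R * s1 - Q * s2 + m12
      - (n11 * a * b + n12 * (a * d + b * c) + n22 * c * d)))
      - e * (a * d - b * c) * (hm12 - (hn11 * a * b + hn12 * (a * d + b * c) + hn22 * c * d))
  · linear_combination (exp := 1) e * (d * e3 - b * e4)
      - he * (Dy s2 - (s2 * s2 + S * s1 - R * s2 + m22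
      - (n11 * b * b + 2 * n12 * b * d + n22 * d * d)))
      - e * (a * d - b * c) * (hm22 - (hn11 * b * b + 2 * hn12 * b * d + hn22 * d * d))

set_option maxHeartbeats 4000000 in
/-- Compatibility of the equations for `σ`: the Cotton-type quantities are tensorial. -/
theorem alg_cotton {A : Type*} [CommRing A] [Algebra ℝ A] (Dx Dy : Derivation ℝ A A)
    (hcomm : ∀ f, Dy (Dx f) = Dx (Dy f))
    (a b c d s1 s2 P Q R S p q r s : A)
    (hxa : Dx a = a * Q - b * P - (q * a * a + 2 * r * a * c + s * c * c) + 2 * s1 * a)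
    (hya : Dy a = a * R - b * Q - (q * a * b + r * (a * d + b * c) + s * c * d) + s1 * b + s2 * a)
    (hxb : Dx b = a * R - b * Q - (q * a * b + r * (a * d + b * c) + s * c * d) + s1 * b + s2 * a)
    (hyb : Dy b = a * S - b * R - (q * b * b + 2 * r * b * d + s * d * d) + 2 * s2 * b)
    (hxc : Dx c = c * Q - d * P + (p * a * a + 2 * q * a * c + r * c * c) + 2 * s1 * c)
    (hyc : Dy c = c * R - d * Q + (p * a * b + q * (a * d + b * c) + r * c * d) + s1 * d + s2 * c)
    (hxd : Dx d = c * R - d * Q + (p * a * b + q * (a * d + b * c) + r * c * d) + s1 * d + s2 * c)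
    (hyd : Dy d = c * S - d * R + (p * b * b + 2 * q * b * d + r * d * d) + 2 * s2 * d)
    (hcurl : Dx s2 = Dy s1)
    (m11 m12 m22 n11 n12 n22 n11x n11y n12x n12y n22x n22y : A)
    (h1x : Dx n11 = n11x * a + n11y * c) (h1y : Dy n11 = n11x * b + n11y * d)
    (h2x : Dx n12 = n12x * a + n12y * c) (h2y : Dy n12 = n12x * b + n12y * d)
    (h3x : Dx n22 = n22x * a + n22y * c) (h3y : Dy n22 = n22x * b + n22y * d)
    (hm11 : m11 = Dx Q - Dy P - 2 * Q * Q + 2 * P * R)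
    (hm12 : m12 = Dx R - Dy Q - Q * R + P * S)
    (hm22 : m22 = Dx S - Dy R - 2 * R * R + 2 * Q * S)
    (t11 : Dx s1 = s1 * s1 + Q * s1 - P * s2 + m11
      - (n11 * a * a + 2 * n12 * a * c + n22 * c * c))
    (t12 : Dy s1 = s1 * s2 + R * s1 - Q * s2 + m12
      - (n11 * a * b + n12 * (a * d + b * c) + n22 * c * d))
    (t22 : Dy s2 = s2 * s2 + S * s1 - R * s2 + m22
      - (n11 * b * b + 2 * n12 * b * d + n22 * d * d)) :
    (Dx m12 - Dy m11 + R * m11 - 2 * Q * m12 + P * m22 =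
      (a * d - b * c) *
       (a * (n12x - n11y + r * n11 - 2 * q * n12 + p * n22)
       + c * (n22x - n12y + s * n11 - 2 * r * n12 + q * n22))) ∧
    (Dx m22 - Dy m12 + S * m11 - 2 * R * m12 + Q * m22 =
      (a * d - b * c) *
       (b * (n12x - n11y + r * n11 - 2 * q * n12 + p * n22)
       + d * (n22x - n12y + s * n11 - 2 * r * n12 + q * n22))) := by
  have e1 := hcomm s1
  have e2 := hcomm s2
  rw [hcurl, t22] at e2
  rw [t11, t12] at e1
  rw [t12] at e2
  simp only [map_add, map_sub, Derivation.leibniz, smul_eq_mul, der_two, hxa, hya, hxb, hyb, hxc, hyc,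
    hxd, hyd, h1x, h1y, h2x, h2y, h3x, h3y, hcurl, t11, t12, t22] at e1 e2
  constructor
  · linear_combination (exp := 1) -e1 + s1 * hm12 - s2 * hm11
  · linear_combination (exp := 1) -e2 + s1 * hm22 - s2 * hm12

/-- Algebraic version of `coefA` for commuting derivations. -/
def algA {A : Type*} [CommRing A] [Algebra ℝ A] (Dx Dy : Derivation ℝ A A) (P Q R S : A) : A :=
  Dy (Dy P) - 2 * Dx (Dy Q) + Dx (Dx R) + 2 * P * Dx S + S * Dx P
    - 3 * P * Dy R - 3 * R * Dy P - 3 * Q * Dx R + 6 * Q * Dy Q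

/-- Algebraic version of `coefB`. -/
def algB {A : Type*} [CommRing A] [Algebra ℝ A] (Dx Dy : Derivation ℝ A A) (P Q R S : A) : A :=
  Dx (Dx S) - 2 * Dx (Dy R) + Dy (Dy Q) - 2 * S * Dy P - P * Dy S
    + 3 * S * Dx Q + 3 * Q * Dx S + 3 * R * Dy Q - 6 * R * Dx R

/-- Algebraic version of `coefG`. -/
def algG {A : Type*} [CommRing A] [Algebra ℝ A] (Dx Dy : Derivation ℝ A A) (P Q R S : A) : A :=
  -(algB Dx Dy P Q R S) * Dx (algB Dx Dy P Q R S)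
    - 3 * algA Dx Dy P Q R S * Dy (algB Dx Dy P Q R S)
    + 4 * algB Dx Dy P Q R S * Dy (algA Dx Dy P Q R S)
    + 3 * S * (algA Dx Dy P Q R S)^2
    - 6 * R * algA Dx Dy P Q R S * algB Dx Dy P Q R S
    + 3 * Q * (algB Dx Dy P Q R S)^2

/-- Algebraic version of `coefH`. -/
def algH {A : Type*} [CommRing A] [Algebra ℝ A] (Dx Dy : Derivation ℝ A A) (P Q R S : A) : A :=
  -(algA Dx Dy P Q R S) * Dy (algA Dx Dy P Q R S)
    - 3 * algB Dx Dy P Q R S * Dx (algA Dx Dy P Q R S)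
    + 4 * algA Dx Dy P Q R S * Dx (algB Dx Dy P Q R S)
    - 3 * P * (algB Dx Dy P Q R S)^2
    + 6 * Q * algA Dx Dy P Q R S * algB Dx Dy P Q R S
    - 3 * R * (algA Dx Dy P Q R S)^2

theorem alg_cotton_A {A : Type*} [CommRing A] [Algebra ℝ A] (Dx Dy : Derivation ℝ A A)
    (hcomm : ∀ f, Dy (Dx f) = Dx (Dy f)) (P Q R S : A) :
    Dx (Dx R - Dy Q - Q * R + P * S) - Dy (Dx Q - Dy P - 2 * Q * Q + 2 * P * R)
      + R * (Dx Q - Dy P - 2 * Q * Q + 2 * P * R) - 2 * Q * (Dx R - Dy Q - Q * R + P * S)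
      + P * (Dx S - Dy R - 2 * R * R + 2 * Q * S) = algA Dx Dy P Q R S := by
  simp only [algA, map_add, map_sub, Derivation.leibniz, smul_eq_mul, der_two, hcomm]
  ring

theorem alg_cotton_B {A : Type*} [CommRing A] [Algebra ℝ A] (Dx Dy : Derivation ℝ A A)
    (hcomm : ∀ f, Dy (Dx f) = Dx (Dy f)) (P Q R S : A) :
    Dx (Dx S - Dy R - 2 * R * R + 2 * Q * S) - Dy (Dx R - Dy Q - Q * R + P * S)
      + S * (Dx Q - Dy P - 2 * Q * Q + 2 * P * R) - 2 * R * (Dx R - Dy Q - Q * R + P * S)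
      + Q * (Dx S - Dy R - 2 * R * R + 2 * Q * S) = algB Dx Dy P Q R S := by
  simp only [algB, map_add, map_sub, Derivation.leibniz, smul_eq_mul, der_two, hcomm]
  ring

set_option maxHeartbeats 4000000 in
/-- Last step: transformation of `G` and `H` from that of `A` and `B`. -/
theorem alg_GH {A : Type*} [CommRing A] [Algebra ℝ A] (Dx Dy : Derivation ℝ A A)
    (a b c d s1 s2 P Q R S p q r s : A)
    (hxa : Dx a = a * Q - b * P - (q * a * a + 2 * r * a * c + s * c * c) + 2 * s1 * a)
    (hya : Dy a = a * R - b * Q - (q * a * b + r * (a * d + b * c) + s * c * d) + s1 * b + s2 * a)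
    (hxb : Dx b = a * R - b * Q - (q * a * b + r * (a * d + b * c) + s * c * d) + s1 * b + s2 * a)
    (hyb : Dy b = a * S - b * R - (q * b * b + 2 * r * b * d + s * d * d) + 2 * s2 * b)
    (hxc : Dx c = c * Q - d * P + (p * a * a + 2 * q * a * c + r * c * c) + 2 * s1 * c)
    (hyc : Dy c = c * R - d * Q + (p * a * b + q * (a * d + b * c) + r * c * d) + s1 * d + s2 * c)
    (hxd : Dx d = c * R - d * Q + (p * a * b + q * (a * d + b * c) + r * c * d) + s1 * d + s2 * c)
    (hyd : Dy d = c * S - d * R + (p * b * b + 2 * q * b * d + r * d * d) + 2 * s2 * d)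
    (J : A) (hJ : J = a * d - b * c) (hxJ : Dx J = 3 * s1 * J) (hyJ : Dy J = 3 * s2 * J)
    (u v ux uy vx vy : A)
    (hux : Dx u = ux * a + uy * c) (huy : Dy u = ux * b + uy * d)
    (hvx : Dx v = vx * a + vy * c) (hvy : Dy v = vx * b + vy * d)
    (X Y : A) (hX : X = J * (a * u + c * v)) (hY : Y = J * (b * u + d * v)) :
    (-Y * Dx Y - 3 * X * Dy Y + 4 * Y * Dy X + 3 * S * X ^ 2 - 6 * R * X * Y + 3 * Q * Y ^ 2
      = J ^ 3 * (d * (-v * vx - 3 * u * vy + 4 * v * uy + 3 * s * u ^ 2 - 6 * r * u * v + 3 * q * v ^ 2)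
        - b * (-u * uy - 3 * v * ux + 4 * u * vx - 3 * p * v ^ 2 + 6 * q * u * v - 3 * r * u ^ 2))) ∧
    (-X * Dy X - 3 * Y * Dx X + 4 * X * Dx Y - 3 * P * Y ^ 2 + 6 * Q * X * Y - 3 * R * X ^ 2
      = J ^ 3 * (-c * (-v * vx - 3 * u * vy + 4 * v * uy + 3 * s * u ^ 2 - 6 * r * u * v + 3 * q * v ^ 2)
        + a * (-u * uy - 3 * v * ux + 4 * u * vx - 3 * p * v ^ 2 + 6 * q * u * v - 3 * r * u ^ 2))) := by
  have kx : Dx X = _ := congrArg Dx hX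
  have ky : Dy X = _ := congrArg Dy hX
  have lx : Dx Y = _ := congrArg Dx hY
  have ly : Dy Y = _ := congrArg Dy hY
  simp only [map_add, Derivation.leibniz, smul_eq_mul, hxa, hya, hxb, hyb, hxc, hyc,
    hxd, hyd, hux, huy, hvx, hvy, hxJ, hyJ] at kx ky lx ly
  rw [kx, ky, lx, ly, hX, hY, pow_succ J 2]
  constructor
  · generalize hK : J ^ 2 = K
    have e1 : ∀ z w : A, z = J * w → J ^ 2 * z = J ^ 2 * J * w := by
      intro z w h; rw [h]; ring
    rw [← hK]
    refine Eq.trans ?_ (e1 _ _ (by rw [hJ]))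
    ring
  · have e1 : ∀ z w : A, z = J * w → J ^ 2 * z = J ^ 2 * J * w := by
      intro z w h; rw [h]; ring
    refine Eq.trans ?_ (e1 _ _ (by rw [hJ]))
    ring

set_option maxHeartbeats 4000000 in
/-- The structure equations for the Jacobian, for one column pair. -/
theorem alg_struct {A : Type*} [CommRing A]
    (a b c d e t1 t2 X1 X2 D1 D2 w1 w2 : A) (he : e * (a * d - b * c) = 1)
    (h1 : t1 = e * (d * (X1 + D1) - b * (X2 + D2)) - w1)
    (h2 : t2 = e * (-c * (X1 + D1) + a * (X2 + D2)) - w2) :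
    D1 = a * t1 + b * t2 - X1 + a * w1 + b * w2 ∧
    D2 = c * t1 + d * t2 - X2 + c * w1 + d * w2 := by
  constructor
  · linear_combination -a * h1 - b * h2 - (X1 + D1) * he
  · linear_combination -c * h1 - d * h2 - (X2 + D2) * he

/-- The covector `σ/3` is closed. -/
theorem alg_curl {A : Type*} [CommRing A] [Algebra ℝ A] (Dx Dy : Derivation ℝ A A)
    (hcomm : ∀ f, Dy (Dx f) = Dx (Dy f)) (J e k s1 s2 : A) (he : e * J = 1) (hk : 3 * k = 1)
    (hxJ : Dx J = 3 * s1 * J) (hyJ : Dy J = 3 * s2 * J) : Dx s2 = Dy s1 := by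
  have h := hcomm J
  rw [hxJ, hyJ] at h
  simp only [Derivation.leibniz, smul_eq_mul, der_three, hxJ, hyJ] at h
  linear_combination -e * k * h - (Dx s2 - Dy s1) * (hk + 3 * k * he)

set_option maxHeartbeats 4000000 in
/-- The whole transformation law in differential-algebraic form. -/
theorem alg_main {A At : Type*} [CommRing A] [Algebra ℝ A] [CommRing At] [Algebra ℝ At]
    (Dx Dy : Derivation ℝ A A) (hcomm : ∀ f, Dy (Dx f) = Dx (Dy f))
    (Ex Ey : Derivation ℝ At At) (hcommt : ∀ f, Ey (Ex f) = Ex (Ey f))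
    (X Y : A) (F : At →+* A) (a b c d : A)
    (ha : a = Dx X) (hb : b = Dy X) (hc : c = Dx Y) (hd : d = Dy Y)
    (hFx : ∀ f, Dx (F f) = F (Ex f) * a + F (Ey f) * c)
    (hFy : ∀ f, Dy (F f) = F (Ex f) * b + F (Ey f) * d)
    (e k s1 s2 P Q R S : A) (p q r s : At)
    (he : e * (a * d - b * c) = 1) (hk : 3 * k = 1)
    (hs1 : s1 = k * e * Dx (a * d - b * c)) (hs2 : s2 = k * e * Dy (a * d - b * c))
    (r11 : Q = e * (d * ((F q * a * a + 2 * F r * a * c + F s * c * c) + Dx a)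
      - b * (-(F p * a * a + 2 * F q * a * c + F r * c * c) + Dx c)) - 2 * s1)
    (r12 : R = e * (d * ((F q * a * b + F r * (a * d + b * c) + F s * c * d) + Dy a)
      - b * (-(F p * a * b + F q * (a * d + b * c) + F r * c * d) + Dy c)) - s2)
    (r13 : S = e * (d * ((F q * b * b + 2 * F r * b * d + F s * d * d) + Dy b)
      - b * (-(F p * b * b + 2 * F q * b * d + F r * d * d) + Dy d)) - 0)
    (r21 : -P = e * (-c * ((F q * a * a + 2 * F r * a * c + F s * c * c) + Dx a)
      + a * (-(F p * a * a + 2 * F q * a * c + F r * c * c) + Dx c)) - 0)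
    (r22 : -Q = e * (-c * ((F q * a * b + F r * (a * d + b * c) + F s * c * d) + Dy a)
      + a * (-(F p * a * b + F q * (a * d + b * c) + F r * c * d) + Dy c)) - s1)
    (r23 : -R = e * (-c * ((F q * b * b + 2 * F r * b * d + F s * d * d) + Dy b)
      + a * (-(F p * b * b + 2 * F q * b * d + F r * d * d) + Dy d)) - 2 * s2) :
    algG Dx Dy P Q R S = (a * d - b * c) ^ 3 *
      (d * F (algG Ex Ey p q r s) - b * F (algH Ex Ey p q r s)) ∧
    algH Dx Dy P Q R S = (a * d - b * c) ^ 3 *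
      (-c * F (algG Ex Ey p q r s) + a * F (algH Ex Ey p q r s)) := by
  have g1 := alg_struct a b c d e _ _ _ _ _ _ _ _ he r11 r21
  have g2 := alg_struct a b c d e _ _ _ _ _ _ _ _ he r12 r22
  have g3 := alg_struct a b c d e _ _ _ _ _ _ _ _ he r13 r23
  clear r11 r12 r13 r21 r22 r23
  have hab : Dx b = Dy a := by rw [hb, ha, hcomm]
  have hcd : Dx d = Dy c := by rw [hd, hc, hcomm]
  have hxa : Dx a = a * Q - b * P - (F q * a * a + 2 * F r * a * c + F s * c * c) + 2 * s1 * a := by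
    linear_combination g1.1
  have hya : Dy a = a * R - b * Q - (F q * a * b + F r * (a * d + b * c) + F s * c * d)
      + s1 * b + s2 * a := by
    linear_combination g2.1
  have hxb : Dx b = a * R - b * Q - (F q * a * b + F r * (a * d + b * c) + F s * c * d)
      + s1 * b + s2 * a := hab.trans hya
  have hyb : Dy b = a * S - b * R - (F q * b * b + 2 * F r * b * d + F s * d * d) + 2 * s2 * b := by
    linear_combination g3.1
  have hxc : Dx c = c * Q - d * P + (F p * a * a + 2 * F q * a * c + F r * c * c) + 2 * s1 * c := by
    linear_combination g1.2
  have hyc : Dy c = c * R - d * Q + (F p * a * b + F q * (a * d + b * c) + F r * c * d)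
      + s1 * d + s2 * c := by
    linear_combination g2.2
  have hxd : Dx d = c * R - d * Q + (F p * a * b + F q * (a * d + b * c) + F r * c * d)
      + s1 * d + s2 * c := hcd.trans hyc
  have hyd : Dy d = c * S - d * R + (F p * b * b + 2 * F q * b * d + F r * d * d) + 2 * s2 * d := by
    linear_combination g3.2
  clear g1 g2 g3
  obtain ⟨J, hJ⟩ : ∃ J, J = a * d - b * c := ⟨_, rfl⟩
  rw [← hJ] at he hs1 hs2 ⊢
  have hxJ : Dx J = 3 * s1 * J := by
    linear_combination -3 * J * hs1 - Dx J * (e * J * hk + he)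
  have hyJ : Dy J = 3 * s2 * J := by
    linear_combination -3 * J * hs2 - Dy J * (e * J * hk + he)
  have hcurl := alg_curl Dx Dy hcomm J e k s1 s2 he hk hxJ hyJ
  have hF2 : F 2 = 2 := map_ofNat F 2
  obtain ⟨t11, t12, t22⟩ := alg_sigma Dx Dy hcomm a b c d e s1 s2 P Q R S (F p) (F q) (F r) (F s)
    (F (Ex p)) (F (Ey p)) (F (Ex q)) (F (Ey q)) (F (Ex r)) (F (Ey r)) (F (Ex s)) (F (Ey s))
    (by rw [← hJ]; exact he) hxa hya hxb hyb hxc hyc hxd hyd hcurl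
    (hFx p) (hFy p) (hFx q) (hFy q) (hFx r) (hFy r) (hFx s) (hFy s)
    _ _ _ (F (Ex q - Ey p - 2 * q * q + 2 * p * r)) (F (Ex r - Ey q - q * r + p * s))
    (F (Ex s - Ey r - 2 * r * r + 2 * q * s)) rfl rfl rfl
    (by simp only [map_sub, map_add, map_mul, hF2]) (by simp only [map_sub, map_add, map_mul])
    (by simp only [map_sub, map_add, map_mul, hF2])
  obtain ⟨cA, cB⟩ := alg_cotton Dx Dy hcomm a b c d s1 s2 P Q R S (F p) (F q) (F r) (F s)
    hxa hya hxb hyb hxc hyc hxd hyd hcurl _ _ _ _ _ _ _ _ _ _ _ _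
    (hFx _) (hFy _) (hFx _) (hFy _) (hFx _) (hFy _) rfl rfl rfl t11 t12 t22
  have dA := congrArg F (alg_cotton_A Ex Ey hcommt p q r s)
  have dB := congrArg F (alg_cotton_B Ex Ey hcommt p q r s)
  rw [map_add F, map_sub F, map_add F, map_sub F, map_mul F r, map_mul F (2 * q), map_mul F p,
    map_mul F 2 q, hF2] at dA
  rw [map_add F, map_sub F, map_add F, map_sub F, map_mul F s, map_mul F (2 * r), map_mul F q,
    map_mul F 2 r, hF2] at dB
  rw [alg_cotton_A Dx Dy hcomm, dA, dB, ← hJ] at cA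
  rw [alg_cotton_B Dx Dy hcomm, dA, dB, ← hJ] at cB
  obtain ⟨hG, hH⟩ := alg_GH Dx Dy a b c d s1 s2 P Q R S (F p) (F q) (F r) (F s)
    hxa hya hxb hyb hxc hyc hxd hyd J hJ hxJ hyJ _ _ _ _ _ _ (hFx _) (hFy _) (hFx _) (hFy _)
    _ _ cA cB
  have hF3 : F 3 = 3 := map_ofNat F 3
  have hF4 : F 4 = 4 := map_ofNat F 4
  have hF6 : F 6 = 6 := map_ofNat F 6
  unfold algG algH
  simp only [map_add F, map_sub F, map_mul F, map_neg F, map_pow F, hF3, hF4, hF6]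
  exact ⟨hG, hH⟩

/-- Smooth functions on an open subset of the plane, as an algebra of functions on that set. -/
def SF (U : TopologicalSpace.Opens (ℝ × ℝ)) : Subalgebra ℝ (U → ℝ) where
  carrier := {g | ∃ f : ℝ × ℝ → ℝ, ContDiffOn ℝ (⊤ : ℕ∞) f U ∧ ∀ p : U, f p = g p}
  mul_mem' := by
    rintro g h ⟨f, hf, hfg⟩ ⟨k, hk, hkh⟩
    exact ⟨fun p => f p * k p, hf.mul hk, fun p => by simp [hfg, hkh]⟩
  add_mem' := by
    rintro g h ⟨f, hf, hfg⟩ ⟨k, hk, hkh⟩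
    exact ⟨fun p => f p + k p, hf.add hk, fun p => by simp [hfg, hkh]⟩
  algebraMap_mem' := fun r => ⟨fun _ => r, contDiffOn_const, fun p => rfl⟩

/-- A chosen smooth representative. -/
def SF.rep {U : TopologicalSpace.Opens (ℝ × ℝ)} (g : SF U) : ℝ × ℝ → ℝ := g.2.choose

theorem SF.rep_smooth {U : TopologicalSpace.Opens (ℝ × ℝ)} (g : SF U) :
    ContDiffOn ℝ (⊤ : ℕ∞) (SF.rep g) U := g.2.choose_spec.1

theorem SF.rep_eq {U : TopologicalSpace.Opens (ℝ × ℝ)} (g : SF U) (p : U) :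
    (SF.rep g) p = g.1 p := g.2.choose_spec.2 p

theorem SF.rep_diff {U : TopologicalSpace.Opens (ℝ × ℝ)} (g : SF U) (p : U) :
    DifferentiableAt ℝ (SF.rep g) p :=
  (((SF.rep_smooth g) p p.2).contDiffAt (U.isOpen.mem_nhds p.2)).differentiableAt (by simp)

theorem SF.rep_fderiv {U : TopologicalSpace.Opens (ℝ × ℝ)} (g : SF U) (f : ℝ × ℝ → ℝ)
    (hf : ∀ p : U, f p = g.1 p) (p : U) : fderiv ℝ (SF.rep g) p = fderiv ℝ f p := by
  apply Filter.EventuallyEq.fderiv_eq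
  filter_upwards [U.isOpen.mem_nhds p.2] with z hz
  rw [(SF.rep_eq g) ⟨z, hz⟩, hf ⟨z, hz⟩]

/-- Directional derivative as a derivation of the algebra of smooth functions. -/
def SF.D {U : TopologicalSpace.Opens (ℝ × ℝ)} (v : ℝ × ℝ) : Derivation ℝ (SF U) (SF U) :=
  Derivation.mk'
    { toFun := fun g => ⟨fun p => fderiv ℝ (SF.rep g) p v, fun z => fderiv ℝ (SF.rep g) z v,
        ((SF.rep_smooth g).fderiv_of_isOpen U.isOpen (by simp)).clm_apply contDiffOn_const,
        fun p => rfl⟩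
      map_add' := by
        intro g h
        ext p
        change fderiv ℝ (SF.rep (g + h)) p v = fderiv ℝ (SF.rep g) p v + fderiv ℝ (SF.rep h) p v
        rw [SF.rep_fderiv (g + h) (fun z => (SF.rep g) z + (SF.rep h) z)
          (fun p => by rw [(SF.rep_eq g), (SF.rep_eq h)]; rfl), fderiv_fun_add ((SF.rep_diff g) p) ((SF.rep_diff h) p)]
        rfl
      map_smul' := by
        intro r g
        ext p
        change fderiv ℝ (SF.rep (r • g)) p v = r * fderiv ℝ (SF.rep g) p v
        rw [SF.rep_fderiv (r • g) (fun z => r * (SF.rep g) z)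
          (fun p => by rw [(SF.rep_eq g)]; rfl), fderiv_const_mul ((SF.rep_diff g) p)]
        rfl }
    (by
      intro g h
      ext p
      change fderiv ℝ (SF.rep (g * h)) p v = g.1 p * fderiv ℝ (SF.rep h) p v + h.1 p * fderiv ℝ (SF.rep g) p v
      rw [SF.rep_fderiv (g * h) (fun z => (SF.rep g) z * (SF.rep h) z)
        (fun p => by rw [(SF.rep_eq g), (SF.rep_eq h)]; rfl), fderiv_fun_mul ((SF.rep_diff g) p) ((SF.rep_diff h) p),
        ← (SF.rep_eq g), ← (SF.rep_eq h)]
      rfl)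

theorem SF.D_apply {U : TopologicalSpace.Opens (ℝ × ℝ)} (v : ℝ × ℝ) (g : SF U) (p : U) :
    (SF.D v g).1 p = fderiv ℝ (SF.rep g) p v := rfl

theorem SF.D_comm {U : TopologicalSpace.Opens (ℝ × ℝ)} (v w : ℝ × ℝ) (g : SF U) :
    SF.D v (SF.D w g) = SF.D w (SF.D v g) := by
  ext p
  have key : ∀ v w : ℝ × ℝ, (SF.D v (SF.D w g)).1 p = fderiv ℝ (fderiv ℝ (SF.rep g)) p v w := by
    intro v w
    rw [SF.D_apply, SF.rep_fderiv (SF.D w g) (fun z => fderiv ℝ (SF.rep g) z w) (fun p => rfl)]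
    have hd : DifferentiableAt ℝ (fderiv ℝ (SF.rep g)) p :=
      ((((SF.rep_smooth g).fderiv_of_isOpen (m := 1) U.isOpen (by norm_cast)) p p.2).contDiffAt
        (U.isOpen.mem_nhds p.2)).differentiableAt (by simp)
    rw [fderiv_clm_apply hd (differentiableAt_const w)]
    simp
  rw [key, key]
  have hc : ContDiffAt ℝ (⊤ : ℕ∞) (SF.rep g) p := ((SF.rep_smooth g) p p.2).contDiffAt (U.isOpen.mem_nhds p.2)
  exact (hc.isSymmSndFDerivAt (by simp; norm_cast)).eq v w

/-- Evaluation at a point. -/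
def SF.ev {U : TopologicalSpace.Opens (ℝ × ℝ)} (p : U) : SF U →+* ℝ where
  toFun g := g.1 p
  map_one' := rfl
  map_mul' _ _ := rfl
  map_zero' := rfl
  map_add' _ _ := rfl

theorem SF.ev_eq {U : TopologicalSpace.Opens (ℝ × ℝ)} (p : U) (g : SF U) : SF.ev p g = g.1 p := rfl

theorem SF.ext_ev {U : TopologicalSpace.Opens (ℝ × ℝ)} {g h : SF U}
    (H : ∀ p, SF.ev p g = SF.ev p h) : g = h := Subtype.ext (funext H)

/-- `g` represents the two-variable function `f` on `U`. -/
def SRep (U : TopologicalSpace.Opens (ℝ × ℝ)) (f : ℝ → ℝ → ℝ) (g : SF U) : Prop :=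
  ∀ (x y : ℝ) (h : (x, y) ∈ U), f x y = SF.ev ⟨(x, y), h⟩ g

theorem SRep.exists {U : TopologicalSpace.Opens (ℝ × ℝ)} {f : ℝ → ℝ → ℝ}
    (h : Smooth2 (U : Set (ℝ × ℝ)) f) : ∃ g : SF U, SRep U f g :=
  ⟨⟨fun p => f p.1.1 p.1.2, Function.uncurry f, h, fun _ => rfl⟩, fun _ _ _ => rfl⟩

theorem SRep.pdx {U : TopologicalSpace.Opens (ℝ × ℝ)} {f : ℝ → ℝ → ℝ} {g : SF U}
    (h : SRep U f g) : SRep U (pdx f) (SF.D (1, 0) g) := by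
  intro x y hp
  rw [SF.ev_eq, SF.D_apply]
  have h1 : HasDerivAt (fun t : ℝ => (SF.rep g) (t, y)) (fderiv ℝ (SF.rep g) (x, y) (1, 0)) x :=
    ((SF.rep_diff g) ⟨(x, y), hp⟩).hasFDerivAt.comp_hasDerivAt x
      ((hasDerivAt_id x).prodMk (hasDerivAt_const x y))
  have hev : (fun t : ℝ => f t y) =ᶠ[nhds x] fun t => (SF.rep g) (t, y) := by
    have hc : ContinuousAt (fun t : ℝ => (t, y)) x := by fun_prop
    filter_upwards [hc.preimage_mem_nhds (U.isOpen.mem_nhds hp)] with t ht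
    exact (h t y ht).trans (SF.rep_eq g ⟨(t, y), ht⟩).symm
  exact (h1.congr_of_eventuallyEq hev).deriv

theorem SRep.pdy {U : TopologicalSpace.Opens (ℝ × ℝ)} {f : ℝ → ℝ → ℝ} {g : SF U}
    (h : SRep U f g) : SRep U (pdy f) (SF.D (0, 1) g) := by
  intro x y hp
  rw [SF.ev_eq, SF.D_apply]
  have h1 : HasDerivAt (fun t : ℝ => (SF.rep g) (x, t)) (fderiv ℝ (SF.rep g) (x, y) (0, 1)) y :=
    ((SF.rep_diff g) ⟨(x, y), hp⟩).hasFDerivAt.comp_hasDerivAt y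
      ((hasDerivAt_const y x).prodMk (hasDerivAt_id y))
  have hev : (fun t : ℝ => f x t) =ᶠ[nhds y] fun t => (SF.rep g) (x, t) := by
    have hc : ContinuousAt (fun t : ℝ => (x, t)) y := by fun_prop
    filter_upwards [hc.preimage_mem_nhds (U.isOpen.mem_nhds hp)] with t ht
    exact (h x t ht).trans (SF.rep_eq g ⟨(x, t), ht⟩).symm
  exact (h1.congr_of_eventuallyEq hev).deriv

/-- Inverse of a nowhere vanishing smooth function. -/
theorem SF.exists_inv {U : TopologicalSpace.Opens (ℝ × ℝ)} (g : SF U) (h : ∀ p, g.1 p ≠ 0) :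
    ∃ e : SF U, e * g = 1 := by
  refine ⟨⟨fun p => (g.1 p)⁻¹, fun z => ((SF.rep g) z)⁻¹, (SF.rep_smooth g).inv ?_, ?_⟩, ?_⟩
  · intro z hz
    rw [(SF.rep_eq g) ⟨z, hz⟩]
    exact h _
  · intro p
    simp only [(SF.rep_eq g)]
  · ext p
    exact inv_mul_cancel₀ (h p)

/-- Pullback along a smooth map. -/
def SF.pull {U Ut : TopologicalSpace.Opens (ℝ × ℝ)} (X Y : SF U)
    (hm : ∀ p : U, (X.1 p, Y.1 p) ∈ Ut) : SF Ut →+* SF U where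
  toFun g := ⟨fun p => g.1 ⟨(X.1 p, Y.1 p), hm p⟩, fun z => (SF.rep g) ((SF.rep X) z, (SF.rep Y) z),
    (SF.rep_smooth g).comp ((SF.rep_smooth X).prodMk (SF.rep_smooth Y)) (fun z hz => by
      rw [(SF.rep_eq X) ⟨z, hz⟩, (SF.rep_eq Y) ⟨z, hz⟩]
      exact hm _), fun p => by
      change SF.rep g (SF.rep X p, SF.rep Y p) = _
      rw [(SF.rep_eq X), (SF.rep_eq Y)]; exact (SF.rep_eq g) ⟨_, hm p⟩⟩
  map_one' := rfl
  map_mul' _ _ := rfl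
  map_zero' := rfl
  map_add' _ _ := rfl

theorem SF.pull_chain {U Ut : TopologicalSpace.Opens (ℝ × ℝ)} (X Y : SF U)
    (hm : ∀ p : U, (X.1 p, Y.1 p) ∈ Ut) (v : ℝ × ℝ) (g : SF Ut) :
    SF.D v (SF.pull X Y hm g) = SF.pull X Y hm (SF.D (1, 0) g) * SF.D v X
      + SF.pull X Y hm (SF.D (0, 1) g) * SF.D v Y := by
  ext p
  change fderiv ℝ (SF.rep (SF.pull X Y hm g)) p v =
    fderiv ℝ (SF.rep g) (X.1 p, Y.1 p) (1, 0) * fderiv ℝ (SF.rep X) p v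
      + fderiv ℝ (SF.rep g) (X.1 p, Y.1 p) (0, 1) * fderiv ℝ (SF.rep Y) p v
  rw [SF.rep_fderiv (SF.pull X Y hm g) (fun z => (SF.rep g) ((SF.rep X) z, (SF.rep Y) z)) (fun p => by
      rw [(SF.rep_eq X), (SF.rep_eq Y)]; exact (SF.rep_eq g) ⟨_, hm p⟩)]
  have hg : HasFDerivAt (SF.rep g) (fderiv ℝ (SF.rep g) (X.1 p, Y.1 p)) ((SF.rep X) p, (SF.rep Y) p) := by
    rw [(SF.rep_eq X), (SF.rep_eq Y)]
    exact ((SF.rep_diff g) ⟨_, hm p⟩).hasFDerivAt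
  have h2 := (hg.comp (p : ℝ × ℝ) (((SF.rep_diff X) p).hasFDerivAt.prodMk ((SF.rep_diff Y) p).hasFDerivAt)).fderiv
  have h3 : fderiv ℝ (fun z => (SF.rep g) ((SF.rep X) z, (SF.rep Y) z)) p = _ := h2
  rw [h3]
  simp only [ContinuousLinearMap.comp_apply, ContinuousLinearMap.prod_apply]
  have h4 : ((fderiv ℝ (SF.rep X) p v, fderiv ℝ (SF.rep Y) p v) : ℝ × ℝ)
      = (fderiv ℝ (SF.rep X) p v) • ((1 : ℝ), (0 : ℝ)) + (fderiv ℝ (SF.rep Y) p v) • ((0 : ℝ), (1 : ℝ)) := by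
    ext <;> simp
  rw [h4, map_add, map_smul, map_smul, smul_eq_mul, smul_eq_mul]
  ring

theorem SRep.coefA {U : TopologicalSpace.Opens (ℝ × ℝ)} {P Q R S : ℝ → ℝ → ℝ} {P' Q' R' S' : SF U}
    (hP : SRep U P P') (hQ : SRep U Q Q') (hR : SRep U R R') (hS : SRep U S S') :
    SRep U (coefA P Q R S) (algA (SF.D (1, 0)) (SF.D (0, 1)) P' Q' R' S') := by
  intro x y h
  simp only [_root_.coefA, algA, map_add, map_sub, map_mul, map_ofNat, hP x y h, hQ x y h, hR x y h, hS x y h,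
    hP.pdx x y h, hP.pdy x y h, hQ.pdy x y h, hR.pdx x y h, hR.pdy x y h, hS.pdx x y h,
    hP.pdy.pdy x y h, hQ.pdy.pdx x y h, hR.pdx.pdx x y h]

theorem SRep.coefB {U : TopologicalSpace.Opens (ℝ × ℝ)} {P Q R S : ℝ → ℝ → ℝ} {P' Q' R' S' : SF U}
    (hP : SRep U P P') (hQ : SRep U Q Q') (hR : SRep U R R') (hS : SRep U S S') :
    SRep U (coefB P Q R S) (algB (SF.D (1, 0)) (SF.D (0, 1)) P' Q' R' S') := by
  intro x y h
  simp only [_root_.coefB, algB, map_add, map_sub, map_mul, map_ofNat, hP x y h, hQ x y h, hR x y h, hS x y h,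
    hP.pdy x y h, hQ.pdx x y h, hQ.pdy x y h, hR.pdx x y h, hS.pdx x y h, hS.pdy x y h,
    hS.pdx.pdx x y h, hR.pdy.pdx x y h, hQ.pdy.pdy x y h]

theorem SRep.coefG {U : TopologicalSpace.Opens (ℝ × ℝ)} {P Q R S : ℝ → ℝ → ℝ} {P' Q' R' S' : SF U}
    (hP : SRep U P P') (hQ : SRep U Q Q') (hR : SRep U R R') (hS : SRep U S S') :
    SRep U (coefG P Q R S) (algG (SF.D (1, 0)) (SF.D (0, 1)) P' Q' R' S') := by
  intro x y h
  have hA := SRep.coefA hP hQ hR hS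
  have hB := SRep.coefB hP hQ hR hS
  simp only [_root_.coefG, algG, map_add, map_sub, map_mul, map_neg, map_pow, map_ofNat, hQ x y h, hR x y h,
    hS x y h, hA x y h, hB x y h, hA.pdy x y h, hB.pdx x y h, hB.pdy x y h]

theorem SRep.coefH {U : TopologicalSpace.Opens (ℝ × ℝ)} {P Q R S : ℝ → ℝ → ℝ} {P' Q' R' S' : SF U}
    (hP : SRep U P P') (hQ : SRep U Q Q') (hR : SRep U R R') (hS : SRep U S S') :
    SRep U (coefH P Q R S) (algH (SF.D (1, 0)) (SF.D (0, 1)) P' Q' R' S') := by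
  intro x y h
  have hA := SRep.coefA hP hQ hR hS
  have hB := SRep.coefB hP hQ hR hS
  simp only [_root_.coefH, algH, map_add, map_sub, map_mul, map_neg, map_pow, map_ofNat, hP x y h, hQ x y h,
    hR x y h, hA x y h, hB x y h, hA.pdx x y h, hA.pdy x y h, hB.pdx x y h]

set_option maxHeartbeats 4000000 in
/-- The pair `β = (G, H)` is pseudovectorial of weight 4. -/
theorem beta_pseudovectorial_weight_four
    (U Ut : Set (ℝ × ℝ)) (hU : IsOpen U) (hUconn : IsConnected U) (hUt : IsOpen Ut)
    (xt yt : ℝ → ℝ → ℝ) (hxt : Smooth2 U xt) (hyt : Smooth2 U yt)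
    (hmaps : ∀ x y : ℝ, (x, y) ∈ U → (xt x y, yt x y) ∈ Ut)
    (hdet : ∀ x y : ℝ, (x, y) ∈ U → Jdet xt yt x y ≠ 0)
    (P Q R S Pt Qt Rt St : ℝ → ℝ → ℝ)
    (hP : Smooth2 U P) (hQ : Smooth2 U Q) (hR : Smooth2 U R) (hS : Smooth2 U S)
    (hPt : Smooth2 Ut Pt) (hQt : Smooth2 Ut Qt) (hRt : Smooth2 Ut Rt) (hSt : Smooth2 Ut St)
    (hrel : PointRelated U xt yt P Q R S Pt Qt Rt St) :
    ∀ x y : ℝ, (x, y) ∈ U →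
      coefG P Q R S x y =
        (Jdet xt yt x y)^4 *
          (Jinv xt yt 0 0 x y * coefG Pt Qt Rt St (xt x y) (yt x y)
            + Jinv xt yt 0 1 x y * coefH Pt Qt Rt St (xt x y) (yt x y)) ∧
      coefH P Q R S x y =
        (Jdet xt yt x y)^4 *
          (Jinv xt yt 1 0 x y * coefG Pt Qt Rt St (xt x y) (yt x y)
            + Jinv xt yt 1 1 x y * coefH Pt Qt Rt St (xt x y) (yt x y)) := by
  obtain ⟨V, rfl⟩ : ∃ V : TopologicalSpace.Opens (ℝ × ℝ), (V : Set (ℝ × ℝ)) = U := ⟨⟨U, hU⟩, rfl⟩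
  obtain ⟨Vt, rfl⟩ : ∃ V : TopologicalSpace.Opens (ℝ × ℝ), (V : Set (ℝ × ℝ)) = Ut :=
    ⟨⟨Ut, hUt⟩, rfl⟩
  obtain ⟨X, hX⟩ := SRep.exists hxt
  obtain ⟨Y, hY⟩ := SRep.exists hyt
  obtain ⟨P', hP'⟩ := SRep.exists hP
  obtain ⟨Q', hQ'⟩ := SRep.exists hQ
  obtain ⟨R', hR'⟩ := SRep.exists hR
  obtain ⟨S', hS'⟩ := SRep.exists hS
  obtain ⟨p, hp⟩ := SRep.exists hPt
  obtain ⟨q, hq⟩ := SRep.exists hQt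
  obtain ⟨r, hr⟩ := SRep.exists hRt
  obtain ⟨s, hs⟩ := SRep.exists hSt
  have hm : ∀ z : V, (X.1 z, Y.1 z) ∈ Vt := by
    rintro ⟨⟨x, y⟩, hz⟩
    have h := hmaps x y hz
    rw [hX x y hz, hY x y hz] at h
    exact h
  obtain ⟨F, hF⟩ : ∃ F, F = SF.pull X Y hm := ⟨_, rfl⟩
  have hcompose : ∀ (f : ℝ → ℝ → ℝ) (g : SF Vt), SRep Vt f g →
      SRep V (fun x y => f (xt x y) (yt x y)) (F g) := by
    intro f g hfg x y hz
    have h1 := hX x y hz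
    have h2 := hY x y hz
    have h3 := hfg _ _ (hm ⟨(x, y), hz⟩)
    rw [hF]
    change f (xt x y) (yt x y) = _
    rw [h1, h2]
    exact h3
  have ra := hX.pdx
  have rb := hX.pdy
  have rc := hY.pdx
  have rd := hY.pdy
  obtain ⟨a, ha⟩ : ∃ a, a = SF.D (1, 0) X := ⟨_, rfl⟩
  obtain ⟨b, hb⟩ : ∃ a, a = SF.D (0, 1) X := ⟨_, rfl⟩
  obtain ⟨c, hc⟩ : ∃ a, a = SF.D (1, 0) Y := ⟨_, rfl⟩
  obtain ⟨d, hd⟩ : ∃ a, a = SF.D (0, 1) Y := ⟨_, rfl⟩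
  rw [← ha] at ra
  rw [← hb] at rb
  rw [← hc] at rc
  rw [← hd] at rd
  have rJ : SRep V (Jdet xt yt) (a * d - b * c) := by
    intro x y hz
    simp only [Jdet, Jmat, pd, map_sub, map_mul, ← ra x y hz, ← rb x y hz, ← rc x y hz, ← rd x y hz]
    simp
  have hJ0 : ∀ z : V, (a * d - b * c).1 z ≠ 0 := by
    rintro ⟨⟨x, y⟩, hz⟩
    have h := hdet x y hz
    rw [rJ x y hz] at h
    exact h
  obtain ⟨e, he⟩ := SF.exists_inv _ hJ0
  have re : ∀ x y (hz : (x, y) ∈ V), SF.ev ⟨(x, y), hz⟩ e = (Jdet xt yt x y)⁻¹ := by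
    intro x y hz
    apply eq_inv_of_mul_eq_one_left
    rw [rJ x y hz, ← map_mul, he, map_one]
  obtain ⟨k, hk, rk⟩ : ∃ k : SF V, 3 * k = 1 ∧ ∀ z, SF.ev z k = 1 / 3 := by
    refine ⟨algebraMap ℝ (SF V) (1 / 3), ?_, fun z => rfl⟩
    apply SF.ext_ev
    intro z
    rw [map_mul, map_one, map_ofNat]
    change (3 : ℝ) * (1 / 3) = 1
    norm_num
  obtain ⟨s1, hs1⟩ : ∃ s1, s1 = k * e * SF.D (1, 0) (a * d - b * c) := ⟨_, rfl⟩
  obtain ⟨s2, hs2⟩ : ∃ s2, s2 = k * e * SF.D (0, 1) (a * d - b * c) := ⟨_, rfl⟩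
  have hrel' : ∀ (i j l : Fin 2) (x y : ℝ) (hz : (x, y) ∈ V), _ :=
    fun i j l x y hz => hrel i j l x y hz
  simp only [Fin.sum_univ_two, Jinv, sigmaT] at hrel'
  have rs1 : ∀ x y (hz : (x, y) ∈ V), SF.ev ⟨(x, y), hz⟩ s1 =
      1 / 3 * (Jdet xt yt x y)⁻¹ * pdx (Jdet xt yt) x y := by
    intro x y hz
    rw [hs1, map_mul, map_mul, rk, re x y hz, ← rJ.pdx x y hz]
  have rs2 : ∀ x y (hz : (x, y) ∈ V), SF.ev ⟨(x, y), hz⟩ s2 =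
      1 / 3 * (Jdet xt yt x y)⁻¹ * pdy (Jdet xt yt) x y := by
    intro x y hz
    rw [hs2, map_mul, map_mul, rk, re x y hz, ← rJ.pdy x y hz]
  have main := alg_main (SF.D (1, 0)) (SF.D (0, 1)) (SF.D_comm _ _) (SF.D (1, 0)) (SF.D (0, 1))
    (SF.D_comm _ _) X Y F a b c d ha hb hc hd
    (fun f => by rw [hF, ha, hc]; exact SF.pull_chain X Y hm _ f)
    (fun f => by rw [hF, hb, hd]; exact SF.pull_chain X Y hm _ f)
    e k s1 s2 P' Q' R' S' p q r s he hk hs1 hs2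
  have hpush : ∀ {g h : SF V}, (∀ x y (hz : (x, y) ∈ V),
      SF.ev ⟨(x, y), hz⟩ g = SF.ev ⟨(x, y), hz⟩ h) → g = h := by
    intro g h H
    apply SF.ext_ev
    rintro ⟨⟨x, y⟩, hz⟩
    exact H x y hz
  have main2 := main ?_ ?_ ?_ ?_ ?_ ?_
  · clear main hrel' hpush
    obtain ⟨mG, mH⟩ := main2
    intro x y hz
    have rG := SRep.coefG hP' hQ' hR' hS' x y hz
    have rH := SRep.coefH hP' hQ' hR' hS' x y hz
    have tG := hcompose _ _ (SRep.coefG hp hq hr hs) x y hz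
    have tH := hcompose _ _ (SRep.coefH hp hq hr hs) x y hz
    have h0 := hdet x y hz
    rw [mG, map_mul, map_pow, ← rJ x y hz, map_sub, map_mul, map_mul, ← tG, ← tH,
      ← rb x y hz, ← rd x y hz] at rG
    rw [mH, map_mul, map_pow, ← rJ x y hz, map_add, map_mul, map_mul, map_neg, ← tG, ← tH,
      ← ra x y hz, ← rc x y hz] at rH
    rw [rG, rH]
    simp only [Jinv, Jmat, pd]
    simp only [if_true, one_ne_zero, if_false]
    constructor
    · field_simp
      try ring
    · field_simp
      try ring
  · apply hpush
    intro x y hz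
    have h := hrel' 0 0 0 x y hz
    simp [thetaUp, thetaLow, Jmat, pd] at h
    simp only [map_sub, map_mul, map_add, map_neg, map_ofNat, map_zero, rs1 x y hz, rs2 x y hz, re x y hz,
      ← ra x y hz, ← rb x y hz, ← rc x y hz, ← rd x y hz, ← ra.pdx x y hz, ← rc.pdx x y hz,
      ← ra.pdy x y hz, ← rc.pdy x y hz, ← rb.pdy x y hz, ← rd.pdy x y hz,
      ← hP' x y hz, ← hQ' x y hz, ← hR' x y hz, ← hS' x y hz,
      ← hcompose _ _ hp x y hz, ← hcompose _ _ hq x y hz, ← hcompose _ _ hr x y hz,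
      ← hcompose _ _ hs x y hz]
    linear_combination (exp := 1) h
  · apply hpush
    intro x y hz
    have h := hrel' 0 1 0 x y hz
    simp [thetaUp, thetaLow, Jmat, pd] at h
    simp only [map_sub, map_mul, map_add, map_neg, map_ofNat, map_zero, rs1 x y hz, rs2 x y hz, re x y hz,
      ← ra x y hz, ← rb x y hz, ← rc x y hz, ← rd x y hz, ← ra.pdx x y hz, ← rc.pdx x y hz,
      ← ra.pdy x y hz, ← rc.pdy x y hz, ← rb.pdy x y hz, ← rd.pdy x y hz,
      ← hP' x y hz, ← hQ' x y hz, ← hR' x y hz, ← hS' x y hz,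
      ← hcompose _ _ hp x y hz, ← hcompose _ _ hq x y hz, ← hcompose _ _ hr x y hz,
      ← hcompose _ _ hs x y hz]
    linear_combination (exp := 1) h
  · apply hpush
    intro x y hz
    have h := hrel' 1 1 0 x y hz
    simp [thetaUp, thetaLow, Jmat, pd] at h
    simp only [map_sub, map_mul, map_add, map_neg, map_ofNat, map_zero, rs1 x y hz, rs2 x y hz, re x y hz,
      ← ra x y hz, ← rb x y hz, ← rc x y hz, ← rd x y hz, ← ra.pdx x y hz, ← rc.pdx x y hz,
      ← ra.pdy x y hz, ← rc.pdy x y hz, ← rb.pdy x y hz, ← rd.pdy x y hz,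
      ← hP' x y hz, ← hQ' x y hz, ← hR' x y hz, ← hS' x y hz,
      ← hcompose _ _ hp x y hz, ← hcompose _ _ hq x y hz, ← hcompose _ _ hr x y hz,
      ← hcompose _ _ hs x y hz]
    linear_combination (exp := 1) h
  · apply hpush
    intro x y hz
    have h := hrel' 0 0 1 x y hz
    simp [thetaUp, thetaLow, Jmat, pd] at h
    simp only [map_sub, map_mul, map_add, map_neg, map_ofNat, map_zero, rs1 x y hz, rs2 x y hz, re x y hz,
      ← ra x y hz, ← rb x y hz, ← rc x y hz, ← rd x y hz, ← ra.pdx x y hz, ← rc.pdx x y hz,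
      ← ra.pdy x y hz, ← rc.pdy x y hz, ← rb.pdy x y hz, ← rd.pdy x y hz,
      ← hP' x y hz, ← hQ' x y hz, ← hR' x y hz, ← hS' x y hz,
      ← hcompose _ _ hp x y hz, ← hcompose _ _ hq x y hz, ← hcompose _ _ hr x y hz,
      ← hcompose _ _ hs x y hz]
    linear_combination (exp := 1) h
  · apply hpush
    intro x y hz
    have h := hrel' 0 1 1 x y hz
    simp [thetaUp, thetaLow, Jmat, pd] at h
    simp only [map_sub, map_mul, map_add, map_neg, map_ofNat, map_zero, rs1 x y hz, rs2 x y hz, re x y hz,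
      ← ra x y hz, ← rb x y hz, ← rc x y hz, ← rd x y hz, ← ra.pdx x y hz, ← rc.pdx x y hz,
      ← ra.pdy x y hz, ← rc.pdy x y hz, ← rb.pdy x y hz, ← rd.pdy x y hz,
      ← hP' x y hz, ← hQ' x y hz, ← hR' x y hz, ← hS' x y hz,
      ← hcompose _ _ hp x y hz, ← hcompose _ _ hq x y hz, ← hcompose _ _ hr x y hz,
      ← hcompose _ _ hs x y hz]
    linear_combination (exp := 1) h
  · apply hpush
    intro x y hz
    have h := hrel' 1 1 1 x y hz
    simp [thetaUp, thetaLow, Jmat, pd] at h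
    simp only [map_sub, map_mul, map_add, map_neg, map_ofNat, map_zero, rs1 x y hz, rs2 x y hz, re x y hz,
      ← ra x y hz, ← rb x y hz, ← rc x y hz, ← rd x y hz, ← ra.pdx x y hz, ← rc.pdx x y hz,
      ← ra.pdy x y hz, ← rc.pdy x y hz, ← rb.pdy x y hz, ← rd.pdy x y hz,
      ← hP' x y hz, ← hQ' x y hz, ← hR' x y hz, ← hS' x y hz,
      ← hcompose _ _ hp x y hz, ← hcompose _ _ hq x y hz, ← hcompose _ _ hr x y hz,
      ← hcompose _ _ hs x y hz]
    linear_combination (exp := 1) h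
end
end
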